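/- arXiv:1809.02692 — 3 statements merged into one kernel-verified Lean document; each statement's English description precedes it below -/
import Mathlib

section
/- Let G be a group with finite generating set S, let Σ = S ∪ S⁻¹, and fix D ≥ 0. Then the language L_D over the alphabet Σ consisting of all D-contracting geodesic words is a regular language; that is, there exists a deterministic finite automaton over Σ (with a finite state set) whose accepted language is exactly L_D. -/
/-! Words over the alphabet `Σ = S ∪ S⁻¹` in a group `G` with finite generating
set `S`, word length, geodesic words, and `D`-contracting geodesic words. -/

section Defs

variable {G : Type*} [Group G]

/-- `g` is a letter of the alphabet `Σ = S ∪ S⁻¹`. -/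
def IsLetter (S : Finset G) (g : G) : Prop := g ∈ S ∨ g⁻¹ ∈ S

/-- The word length `|g|`: the minimum length of a list over `Σ = S ∪ S⁻¹`
whose product is `g`. -/
noncomputable def wordLength (S : Finset G) (g : G) : ℕ :=
  sInf {n | ∃ l : List G, (∀ x ∈ l, IsLetter S x) ∧ l.prod = g ∧ l.length = n}

/-- The word metric `d(g,h) = |g⁻¹h|`. -/
noncomputable def wordDist (S : Finset G) (g h : G) : ℕ := wordLength S (g⁻¹ * h)

/-- A word (list of letters of `Σ`) is geodesic if the word length of its
product equals its length. -/
def IsGeodesicWord (S : Finset G) (w : List G) : Prop :=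
  (∀ x ∈ w, IsLetter S x) ∧ wordLength S w.prod = w.length

/-- `P_{i,j}(w)`: the vertices `a₁⋯a_k` for `i ≤ k ≤ j` of the subsegment of
the path of prefix products of `w`. -/
def segVerts (w : List G) (i j : ℕ) : Set G :=
  {g | ∃ k, i ≤ k ∧ k ≤ j ∧ (w.take k).prod = g}

/-- The closed ball of radius `r` about `g₀` in the word metric. -/
def wordBall (S : Finset G) (g₀ : G) (r : ℕ) : Set G :=
  {h | wordDist S g₀ h ≤ r}

/-- The projection `π_P(x)` of a point `x` to a subset `P` of `G`:
the points of `P` at minimal word-metric distance from `x`. -/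
def projPt (S : Finset G) (P : Set G) (x : G) : Set G :=
  {p ∈ P | ∀ q ∈ P, wordDist S x p ≤ wordDist S x q}

/-- The projection `π_P(B) = ⋃_{x ∈ B} π_P(x)` of a set `B` to `P`. -/
def projSet (S : Finset G) (P B : Set G) : Set G :=
  ⋃ x ∈ B, projPt S P x

/-- A word `w` over `Σ` is a `D`-contracting geodesic word if it is geodesic
and, for every `0 ≤ i ≤ j ≤ |w|` and every ball `B` (in the word metric)
disjoint from `P_{i,j}(w)`, the diameter of `π_{P_{i,j}(w)}(B)` in the word
metric is at most `D`. -/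
def IsContractingWord (S : Finset G) (D : ℝ) (w : List G) : Prop :=
  IsGeodesicWord S w ∧
    ∀ i j : ℕ, i ≤ j → j ≤ w.length → ∀ g₀ : G, ∀ r : ℕ,
      Disjoint (wordBall S g₀ r) (segVerts w i j) →
        ∀ p ∈ projSet S (segVerts w i j) (wordBall S g₀ r),
          ∀ q ∈ projSet S (segVerts w i j) (wordBall S g₀ r),
            (wordDist S p q : ℝ) ≤ D

end Defs

section Aux

variable {G : Type} [Group G]

lemma letter_inv {S : Finset G} {g : G} (h : IsLetter S g) : IsLetter S g⁻¹ := by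
  unfold IsLetter at *
  rw [inv_inv]
  exact h.symm

lemma wl_le {S : Finset G} (l : List G) (hl : ∀ x ∈ l, IsLetter S x) :
    wordLength S l.prod ≤ l.length :=
  Nat.sInf_le ⟨l, hl, rfl, rfl⟩

lemma wl_ex {S : Finset G} (hS : Subgroup.closure (S : Set G) = ⊤) (g : G) :
    ∃ l : List G, (∀ x ∈ l, IsLetter S x) ∧ l.prod = g ∧ l.length = wordLength S g := by
  have hne : {n | ∃ l : List G, (∀ x ∈ l, IsLetter S x) ∧ l.prod = g ∧ l.length = n}.Nonempty := by
    have hg : g ∈ Subgroup.closure (S : Set G) := by rw [hS]; trivial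
    rw [← Subgroup.mem_toSubmonoid, Subgroup.closure_toSubmonoid] at hg
    obtain ⟨l, hl, hp⟩ := Submonoid.exists_list_of_mem_closure hg
    exact ⟨l.length, l, fun x hx => by simpa [IsLetter] using hl x hx, hp, rfl⟩
  exact Nat.sInf_mem hne

lemma wl_one (S : Finset G) : wordLength S 1 = 0 := by
  have := wl_le (S := S) [] (by simp)
  simpa using this

lemma wl_mul {S : Finset G} (hS : Subgroup.closure (S : Set G) = ⊤) (g h : G) :
    wordLength S (g * h) ≤ wordLength S g + wordLength S h := by
  obtain ⟨l, hl, hp, hn⟩ := wl_ex hS g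
  obtain ⟨l', hl', hp', hn'⟩ := wl_ex hS h
  have := wl_le (S := S) (l ++ l') (by
    intro x hx
    rcases List.mem_append.1 hx with h | h
    · exact hl x h
    · exact hl' x h)
  rw [List.prod_append, hp, hp', List.length_append] at this
  omega

lemma wl_inv_le {S : Finset G} (hS : Subgroup.closure (S : Set G) = ⊤) (g : G) :
    wordLength S g⁻¹ ≤ wordLength S g := by
  obtain ⟨l, hl, hp, hn⟩ := wl_ex hS g
  have := wl_le (S := S) (l.map (·⁻¹)).reverse (by
    intro x hx
    simp only [List.mem_reverse, List.mem_map] at hx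
    obtain ⟨y, hy, rfl⟩ := hx
    exact letter_inv (hl y hy))
  rw [← List.prod_inv_reverse, hp] at this
  simpa [hn] using this

lemma wl_inv {S : Finset G} (hS : Subgroup.closure (S : Set G) = ⊤) (g : G) :
    wordLength S g⁻¹ = wordLength S g :=
  le_antisymm (wl_inv_le hS g) (by simpa using wl_inv_le hS g⁻¹)

lemma wl_zero {S : Finset G} (hS : Subgroup.closure (S : Set G) = ⊤) {g : G}
    (h : wordLength S g = 0) : g = 1 := by
  obtain ⟨l, hl, hp, hn⟩ := wl_ex hS g
  rw [h, List.length_eq_zero_iff] at hn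
  subst hn
  simpa using hp.symm

lemma wd_self (S : Finset G) (g : G) : wordDist S g g = 0 := by
  simp [wordDist, wl_one]

lemma wd_comm {S : Finset G} (hS : Subgroup.closure (S : Set G) = ⊤) (g h : G) :
    wordDist S g h = wordDist S h g := by
  unfold wordDist
  rw [← wl_inv hS]
  simp

lemma wd_tri {S : Finset G} (hS : Subgroup.closure (S : Set G) = ⊤) (g h k : G) :
    wordDist S g k ≤ wordDist S g h + wordDist S h k := by
  unfold wordDist
  have := wl_mul hS (g⁻¹ * h) (h⁻¹ * k)
  simpa [mul_assoc] using this

lemma wd_zero {S : Finset G} (hS : Subgroup.closure (S : Set G) = ⊤) {g h : G}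
    (h0 : wordDist S g h = 0) : g = h := by
  have := wl_zero hS h0
  rwa [inv_mul_eq_one] at this

lemma wd_left (S : Finset G) (a g h : G) : wordDist S (a * g) (a * h) = wordDist S g h := by
  unfold wordDist
  simp [mul_assoc]

/-- `P` satisfies the ball-contraction condition. -/
def GoodSet (S : Finset G) (D : ℝ) (P : Set G) : Prop :=
  ∀ g₀ : G, ∀ r : ℕ, Disjoint (wordBall S g₀ r) P →
    ∀ p ∈ projSet S P (wordBall S g₀ r), ∀ q ∈ projSet S P (wordBall S g₀ r),
      (wordDist S p q : ℝ) ≤ D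

lemma goodSet_iff (S : Finset G) (D : ℝ) (P : Set G) : GoodSet S D P ↔
    ∀ g₀ : G, ∀ r : ℕ, (∀ p ∈ P, r < wordDist S g₀ p) →
      ∀ x y p q, wordDist S g₀ x ≤ r → wordDist S g₀ y ≤ r → p ∈ P → q ∈ P →
      (∀ z ∈ P, wordDist S x p ≤ wordDist S x z) →
      (∀ z ∈ P, wordDist S y q ≤ wordDist S y z) → (wordDist S p q : ℝ) ≤ D := by
  unfold GoodSet
  refine forall_congr' fun g₀ => forall_congr' fun r => ?_
  have h1 : Disjoint (wordBall S g₀ r) P ↔ (∀ p ∈ P, r < wordDist S g₀ p) := by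
    rw [Set.disjoint_right]
    simp [wordBall]
  rw [h1]
  refine forall_congr' fun _ => ?_
  simp only [projSet, projPt, wordBall, Set.mem_iUnion, Set.mem_ofPred_eq]
  constructor
  · intro h x y p q hx hy hp hq hpx hqy
    exact h p ⟨x, hx, hp, hpx⟩ q ⟨y, hy, hq, hqy⟩
  · rintro h p ⟨x, hx, hp, hpx⟩ q ⟨y, hy, hq, hqy⟩
    exact h x y p q hx hy hp hq hpx hqy

lemma goodSet_translate (S : Finset G) (D : ℝ) (P : Set G) (a : G) (h : GoodSet S D P) :
    GoodSet S D ((a * ·) '' P) := by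
  rw [goodSet_iff] at *
  have key : ∀ x z, wordDist S x (a * z) = wordDist S (a⁻¹ * x) z := by
    intro x z
    rw [← wd_left S a (a⁻¹ * x) z]; simp
  intro g₀ r hd x y p q hx hy hp hq hpx hqy
  obtain ⟨p, hp, rfl⟩ := hp
  obtain ⟨q, hq, rfl⟩ := hq
  simp only [Set.forall_mem_image, key] at hd hpx hqy
  rw [wd_left]
  exact h (a⁻¹ * g₀) r (fun p hp => hd hp) (a⁻¹ * x) (a⁻¹ * y) p q
    (by rwa [wd_left]) (by rwa [wd_left]) hp hq (fun z hz => hpx hz) (fun z hz => hqy hz)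

lemma goodSet_translate_iff (S : Finset G) (D : ℝ) (P : Set G) (a : G) :
    GoodSet S D ((a * ·) '' P) ↔ GoodSet S D P := by
  refine ⟨fun h => ?_, goodSet_translate S D P a⟩
  have := goodSet_translate S D _ a⁻¹ h
  rw [Set.image_image] at this
  simpa using this

lemma contr_iff (S : Finset G) (D : ℝ) (w : List G) : IsContractingWord S D w ↔
    IsGeodesicWord S w ∧ ∀ i j, i ≤ j → j ≤ w.length → GoodSet S D (segVerts w i j) := Iff.rfl

lemma segVerts_factor (s t e : List G) (i j : ℕ) (hj : j ≤ t.length) :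
    segVerts (s ++ t ++ e) (s.length + i) (s.length + j) = (s.prod * ·) '' segVerts t i j := by
  have key : ∀ k ≤ t.length, ((s ++ t ++ e).take (s.length + k)).prod
      = s.prod * (t.take k).prod := by
    intro k hk
    rw [List.append_assoc, List.take_length_add_append, List.take_append_of_le_length hk,
      List.prod_append]
  ext g
  simp only [segVerts, Set.mem_ofPred_eq, Set.mem_image]
  constructor
  · rintro ⟨k, h1, h2, rfl⟩
    obtain ⟨k, rfl⟩ : ∃ k', k = s.length + k' := ⟨k - s.length, by omega⟩
    exact ⟨_, ⟨k, by omega, by omega, rfl⟩, (key k (by omega)).symm⟩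
  · rintro ⟨_, ⟨k, h1, h2, rfl⟩, rfl⟩
    exact ⟨s.length + k, by omega, by omega, key k (by omega)⟩

lemma geod_factor {S : Finset G} (hS : Subgroup.closure (S : Set G) = ⊤) (s t e : List G)
    (h : IsGeodesicWord S (s ++ t ++ e)) : IsGeodesicWord S t := by
  obtain ⟨h1, h2⟩ := h
  have hs : ∀ x ∈ s, IsLetter S x := fun x hx => h1 x (by simp [hx])
  have ht : ∀ x ∈ t, IsLetter S x := fun x hx => h1 x (by simp [hx])
  have he : ∀ x ∈ e, IsLetter S x := fun x hx => h1 x (by simp [hx])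
  refine ⟨ht, ?_⟩
  have a1 := wl_le s hs
  have a2 := wl_le t ht
  have a3 := wl_le e he
  have a4 := wl_mul hS (s.prod * t.prod) e.prod
  have a5 := wl_mul hS s.prod t.prod
  simp only [List.prod_append, List.length_append] at h2
  omega

lemma contr_factor {S : Finset G} (hS : Subgroup.closure (S : Set G) = ⊤) {D : ℝ} {t w : List G}
    (htw : t <:+: w) (h : IsContractingWord S D w) : IsContractingWord S D t := by
  obtain ⟨s, e, rfl⟩ := htw
  rw [contr_iff] at *
  refine ⟨geod_factor hS s t e h.1, fun i j hij hj => ?_⟩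
  have := h.2 (s.length + i) (s.length + j) (by omega) (by simp; omega)
  rwa [segVerts_factor s t e i j hj, goodSet_translate_iff] at this

lemma geod_dist {S : Finset G} (hS : Subgroup.closure (S : Set G) = ⊤) {w : List G}
    (h : IsGeodesicWord S w) {a b : ℕ} (hab : a ≤ b) (hb : b ≤ w.length) :
    wordDist S (w.take a).prod (w.take b).prod = b - a := by
  have e1 : w.take b = w.take a ++ (w.drop a).take (b - a) := by
    have : b = a + (b - a) := by omega
    conv_lhs => rw [this, List.take_add]
  have e2 : w = w.take a ++ (w.drop a).take (b - a) ++ w.drop b := by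
    rw [← e1, List.take_append_drop]
  have := geod_factor hS _ _ _ (e2 ▸ h)
  unfold wordDist
  rw [e1, List.prod_append, inv_mul_cancel_left, this.2, List.length_take, List.length_drop]
  omega

lemma exists_proj (S : Finset G) {P : Set G} (hP : P.Nonempty) (x : G) :
    ∃ p ∈ P, ∀ z ∈ P, wordDist S x p ≤ wordDist S x z := by
  obtain ⟨p, hp, h⟩ := (measure (fun z => wordDist S x z)).wf.has_min P hP
  exact ⟨p, hp, fun z hz => not_lt.1 (h z hz)⟩

/-- A point at distance one from the end of a geodesic from `y` to `q`. -/
lemma exists_before {S : Finset G} (hS : Subgroup.closure (S : Set G) = ⊤) (y q : G)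
    (h : 1 ≤ wordDist S y q) : ∃ m, wordDist S y m = wordDist S y q - 1 ∧ wordDist S m q = 1 := by
  obtain ⟨l, hl, hp, hn⟩ := wl_ex hS (y⁻¹ * q)
  have hg : IsGeodesicWord S l := ⟨hl, by rw [hp, hn]⟩
  have hn' : l.length = wordDist S y q := hn
  have h1 := geod_dist hS hg (a := 0) (b := l.length - 1) (by omega) (by omega)
  have h2 := geod_dist hS hg (a := l.length - 1) (b := l.length) (by omega) (by omega)
  refine ⟨y * (l.take (l.length - 1)).prod, ?_, ?_⟩
  · rw [← wd_left S y] at h1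
    simp at h1
    rw [h1]; omega
  · rw [← wd_left S y, List.take_length, hp] at h2
    simp at h2
    rw [h2]; omega

lemma wlog_ends {S : Finset G} (hS : Subgroup.closure (S : Set G) = ⊤) {D : ℝ} {w : List G}
    (hw : IsGeodesicWord S w) (E : ℕ) (hE : ∀ n : ℕ, (n : ℝ) ≤ D ↔ n ≤ E)
    (i j : ℕ) (hij : i ≤ j) (hj : j ≤ w.length) (hlong : 2 * E + 3 < j - i)
    (hmin : ∀ i' j', i' ≤ j' → i ≤ i' → j' ≤ j → j' - i' < j - i →
      GoodSet S D (segVerts w i' j'))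
    (g₀ : G) (r : ℕ) (hd : ∀ p ∈ segVerts w i j, r < wordDist S g₀ p) (x y : G) (a b : ℕ)
    (hx : wordDist S g₀ x ≤ r) (hy : wordDist S g₀ y ≤ r) (hia : i ≤ a) (hab : a ≤ b) (hb : b ≤ j)
    (hpx : ∀ z ∈ segVerts w i j, wordDist S x (w.take a).prod ≤ wordDist S x z)
    (hqy : ∀ z ∈ segVerts w i j, wordDist S y (w.take b).prod ≤ wordDist S y z) :
    wordDist S (w.take a).prod (w.take b).prod ≤ E := by
  have hsub : ∀ i' j', i ≤ i' → j' ≤ j → segVerts w i' j' ⊆ segVerts w i j := by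
    rintro i' j' h1 h2 _ ⟨k, h3, h4, rfl⟩
    exact ⟨k, by omega, by omega, rfl⟩
  by_cases hc : b - a < j - i
  · have := (goodSet_iff _ _ _).1 (hmin a b hab hia hb hc) g₀ r
      (fun p hp => hd p (hsub a b hia hb hp)) x y _ _ hx hy ⟨a, le_rfl, hab, rfl⟩
      ⟨b, hab, le_rfl, rfl⟩ (fun z hz => hpx z (hsub a b hia hb hz))
      (fun z hz => hqy z (hsub a b hia hb hz))
    exact (hE _).1 this
  · obtain rfl : a = i := by omega
    obtain rfl : b = j := by omega
    exfalso
    set P' := segVerts w a (b - 1) with hP'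
    have hgood := (goodSet_iff _ _ _).1 (hmin a (b - 1) (by omega) le_rfl (by omega) (by omega))
    have hP'sub : P' ⊆ segVerts w a b := hsub a (b - 1) le_rfl (by omega)
    have hne : P'.Nonempty := ⟨_, a, le_rfl, by omega, rfl⟩
    have haP : (w.take a).prod ∈ P' := ⟨a, le_rfl, by omega, rfl⟩
    have hbP : (w.take (b-1)).prod ∈ P' := ⟨b-1, by omega, by omega, rfl⟩
    obtain ⟨p', hp', hp'min⟩ := exists_proj S hne y
    have h1 := (hE _).1 (hgood g₀ r (fun p hp => hd p (hP'sub hp)) x y _ p' hx hy haP hp'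
      (fun z hz => hpx z (hP'sub hz)) hp'min)
    have hqd := hd _ (⟨b, by omega, le_rfl, rfl⟩ : (w.take b).prod ∈ segVerts w a b)
    have hR : 1 ≤ wordDist S y (w.take b).prod := by
      have := wd_tri hS g₀ y (w.take b).prod
      omega
    obtain ⟨m, hm1, hm2⟩ := exists_before hS y (w.take b).prod hR
    obtain ⟨m', hm', hm'min⟩ := exists_proj S hne m
    have h2 := (hE _).1 (hgood y (wordDist S y (w.take b).prod - 1)
      (fun p hp => by have := hqy p (hP'sub hp); omega) y m p' m'
      (by rw [wd_self]; omega) (by omega) hp' hm' hp'min hm'min)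
    have h3 := hm'min _ hbP
    have h4 := wd_tri hS m (w.take b).prod (w.take (b-1)).prod
    have h5 := geod_dist hS hw (a := b - 1) (b := b) (by omega) hj
    rw [wd_comm hS] at h5
    have h6 := geod_dist hS hw hab hj
    have h7 := wd_tri hS (w.take a).prod p' (w.take b).prod
    have h8 := wd_tri hS p' m' (w.take b).prod
    have h9 := wd_tri hS m' m (w.take b).prod
    have h10 := wd_comm hS m' m
    omega

lemma local_to_global {S : Finset G} (hS : Subgroup.closure (S : Set G) = ⊤) {D : ℝ} {w : List G}
    (hw : IsGeodesicWord S w) (E : ℕ) (hE : ∀ n : ℕ, (n : ℝ) ≤ D ↔ n ≤ E)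
    (hloc : ∀ i j, i ≤ j → j ≤ w.length → j - i ≤ 2 * E + 3 → GoodSet S D (segVerts w i j)) :
    IsContractingWord S D w := by
  rw [contr_iff]
  refine ⟨hw, ?_⟩
  suffices H : ∀ n i j, j - i = n → i ≤ j → j ≤ w.length → GoodSet S D (segVerts w i j) from
    fun i j h1 h2 => H _ i j rfl h1 h2
  intro n
  induction n using Nat.strong_induction_on with
  | _ n ih =>
    intro i j hn hij hj
    by_cases hs : j - i ≤ 2 * E + 3
    · exact hloc i j hij hj hs
    · have hmin : ∀ i' j', i' ≤ j' → i ≤ i' → j' ≤ j → j' - i' < j - i →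
          GoodSet S D (segVerts w i' j') := fun i' j' h1 h2 h3 h4 =>
        ih (j' - i') (by omega) i' j' rfl h1 (by omega)
      rw [goodSet_iff]
      rintro g₀ r hd x y _ _ hx hy ⟨a, ha1, ha2, rfl⟩ ⟨b, hb1, hb2, rfl⟩ hpx hqy
      rw [hE]
      rcases le_total a b with hab | hab
      · exact wlog_ends hS hw E hE i j hij hj (by omega) hmin g₀ r hd x y a b hx hy ha1 hab hb2
          hpx hqy
      · rw [wd_comm hS]
        exact wlog_ends hS hw E hE i j hij hj (by omega) hmin g₀ r hd y x b a hy hx hb1 hab ha2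
          hqy hpx

lemma morse {S : Finset G} (hS : Subgroup.closure (S : Set G) = ⊤) {D : ℝ} {P : Set G}
    (E : ℕ) (hE : ∀ n : ℕ, (n : ℝ) ≤ D ↔ n ≤ E) (hP : GoodSet S D P) (γ : ℕ → G) (m : ℕ)
    (hγ : ∀ s t, s ≤ t → t ≤ m → wordDist S (γ s) (γ t) = t - s)
    (p₀ p₁ : G) (hp₀ : p₀ ∈ P) (hp₁ : p₁ ∈ P) (h0 : wordDist S (γ 0) p₀ ≤ 1)
    (h1 : wordDist S (γ m) p₁ ≤ 1) (t : ℕ) (ht : t ≤ m) :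
    ∃ p ∈ P, wordDist S (γ t) p ≤ 5 * E + 5 := by
  rw [goodSet_iff] at hP
  choose π hπP hπ using exists_proj S (P := P) ⟨p₀, hp₀⟩
  set ρ : ℕ → ℕ := fun t => wordDist S (γ t) (π (γ t)) with hρ
  have key : ∀ s t, wordDist S (γ s) (γ t) + 1 ≤ ρ s →
      wordDist S (π (γ s)) (π (γ t)) ≤ E := by
    intro s t hst
    exact (hE _).1 (hP (γ s) (ρ s - 1) (fun p hp => by
        have := hπ (γ s) p hp
        have : ρ s ≤ wordDist S (γ s) p := this
        omega) (γ s) (γ t) _ _ (by rw [wd_self]; omega) (by omega) (hπP _) (hπP _)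
        (hπ _) (hπ _))
  have low : ∀ t ≤ m, ρ t ≤ t + 1 := by
    intro t ht
    have a1 : ρ t ≤ _ := hπ (γ t) p₀ hp₀
    have a2 := wd_tri hS (γ t) (γ 0) p₀
    have a3 := hγ 0 t (by omega) ht
    rw [wd_comm hS] at a3
    omega
  have high : ∀ t ≤ m, ρ t ≤ (m - t) + 1 := by
    intro t ht
    have a1 : ρ t ≤ _ := hπ (γ t) p₁ hp₁
    have a2 := wd_tri hS (γ t) (γ m) p₁
    have a3 := hγ t m ht le_rfl
    omega
  have tri : ∀ s t, s ≤ t → t ≤ m → t - s ≤ ρ s + wordDist S (π (γ s)) (π (γ t)) + ρ t := by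
    intro s t hst ht
    have a1 := hγ s t hst ht
    have a2 := wd_tri hS (γ s) (π (γ s)) (γ t)
    have a3 := wd_tri hS (π (γ s)) (π (γ t)) (γ t)
    have a4 := wd_comm hS (π (γ t)) (γ t)
    simp only [hρ]
    omega
  obtain ⟨t₀, ht₀, hmax⟩ := Finset.exists_max_image (Finset.range (m + 1)) ρ ⟨0, by simp⟩
  simp only [Finset.mem_range] at ht₀ hmax
  refine ⟨π (γ t), hπP _, ?_⟩
  have hle : ρ t ≤ ρ t₀ := hmax t (by omega)
  change ρ t ≤ _
  suffices ρ t₀ ≤ 5 * E + 5 by omega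
  by_contra hbig
  have b1 := low t₀ (by omega)
  have b2 := high t₀ (by omega)
  obtain ⟨s, hs⟩ : ∃ s, s = t₀ - (ρ t₀ - 1) := ⟨_, rfl⟩
  obtain ⟨u, hu⟩ : ∃ u, u = t₀ + (ρ t₀ - 1) := ⟨_, rfl⟩
  have c1 := hγ s t₀ (by omega) (by omega)
  rw [wd_comm hS] at c1
  have c2 := hγ t₀ u (by omega) (by omega)
  have d1 := key t₀ s (by omega)
  have d2 := key t₀ u (by omega)
  have e1 := wd_tri hS (π (γ s)) (π (γ t₀)) (π (γ u))
  have e2 := wd_comm hS (π (γ s)) (π (γ t₀))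
  have f1 := tri s u (by omega) (by omega)
  have g1 := hmax s (by omega)
  have g2 := hmax u (by omega)
  have hu2 := high u (by omega)
  obtain ⟨v, hv⟩ : ∃ v, v = u + (ρ u - 1) := ⟨_, rfl⟩
  have c3 := hγ u v (by omega) (by omega)
  have d3 := key u v (by omega)
  have e3 := wd_tri hS (π (γ s)) (π (γ u)) (π (γ v))
  have f2 := tri s v (by omega) (by omega)
  have g3 := hmax v (by omega)
  omega

lemma shortcut {S : Finset G} (hS : Subgroup.closure (S : Set G) = ⊤) {D : ℝ}
    (E : ℕ) (hE : ∀ n : ℕ, (n : ℝ) ≤ D ↔ n ≤ E) (w v : List G) (a : G) (ha : IsLetter S a)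
    (hc : IsContractingWord S D (w ++ v)) (hng : ¬ IsGeodesicWord S (w ++ v ++ [a])) :
    ∃ h : G, wordLength S h ≤ 10 * E + 11 ∧
      wordLength S (w.prod * h) + wordLength S (h⁻¹ * v.prod * a) ≤ w.length + v.length := by
  rw [contr_iff] at hc
  obtain ⟨hg, hc⟩ := hc
  have hlet : ∀ x ∈ w ++ v ++ [a], IsLetter S x := by
    intro x hx
    rcases List.mem_append.1 hx with h | h
    · exact hg.1 x h
    · simp at h; exact h ▸ ha
  have hlen := wl_le _ hlet
  have hne : wordLength S (w ++ v ++ [a]).prod ≠ (w ++ v ++ [a]).length :=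
    fun h => hng ⟨hlet, h⟩
  obtain ⟨l, hl, hp, hn⟩ := wl_ex hS (w ++ v ++ [a]).prod
  have hgl : IsGeodesicWord S l := ⟨hl, by rw [hp, hn]⟩
  have ha1 : wordLength S a ≤ 1 := by simpa using wl_le [a] (by simpa using ha)
  have hend : wordDist S l.prod (w ++ v).prod ≤ 1 := by
    rw [wd_comm hS, hp]
    unfold wordDist
    rw [List.prod_append (l₁ := w ++ v), inv_mul_cancel_left]
    simpa using ha1
  have hfull := hg.2
  simp only [List.length_append, List.length_singleton] at hlen hne hfull
  have hm : w.length + v.length ≤ l.length + 1 := by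
    have t1 := wd_tri hS 1 l.prod (w ++ v).prod
    have t2 : wordDist S 1 l.prod = l.length := by simpa [wordDist] using hgl.2
    have t3 : wordDist S 1 (w ++ v).prod = w.length + v.length := by
      simpa [wordDist] using hfull
    omega
  obtain ⟨t, ht⟩ : ∃ t, t = min w.length l.length := ⟨_, rfl⟩
  obtain ⟨_, ⟨j, -, hj, rfl⟩, hpj⟩ := morse hS E hE
    (hc 0 (w ++ v).length (by omega) le_rfl) (fun t => (l.take t).prod) l.length
    (fun s t hst ht => geod_dist hS hgl hst ht) 1 (w ++ v).prod
    ⟨0, le_rfl, by omega, by simp⟩ ⟨(w ++ v).length, by omega, le_rfl, by rw [List.take_length]⟩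
    (by simp [wd_self]) (by simpa using hend) t (by omega)
  simp only [List.length_append] at hj
  have q1 : wordDist S 1 (l.take t).prod = t := by
    simpa using geod_dist hS hgl (a := 0) (b := t) (by omega) (by omega)
  have q2 : wordDist S 1 ((w ++ v).take j).prod = j := by
    simpa using geod_dist hS hg (a := 0) (b := j) (by omega) (by simp; omega)
  have q3 := wd_tri hS 1 (l.take t).prod ((w ++ v).take j).prod
  have q4 := wd_tri hS 1 ((w ++ v).take j).prod (l.take t).prod
  have q5 := wd_comm hS (l.take t).prod ((w ++ v).take j).prod
  have q6 : wordDist S w.prod ((w ++ v).take j).prod ≤ 5 * E + 6 := by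
    have ew : w = (w ++ v).take w.length := by simp
    rcases le_total w.length j with h | h
    · have := geod_dist hS hg h (by simp; omega)
      rw [← ew] at this
      omega
    · have := geod_dist hS hg h (by simp)
      rw [← ew, wd_comm hS] at this
      omega
  have q7 := wd_tri hS w.prod ((w ++ v).take j).prod (l.take t).prod
  refine ⟨w.prod⁻¹ * (l.take t).prod, ?_, ?_⟩
  · change wordDist S _ _ ≤ _
    omega
  · have r1 : wordLength S (w.prod * (w.prod⁻¹ * (l.take t).prod)) = t := by
      simpa [wordDist] using q1
    have r2 : wordLength S ((w.prod⁻¹ * (l.take t).prod)⁻¹ * v.prod * a) = l.length - t := by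
      have := geod_dist hS hgl (a := t) (b := l.length) (by omega) le_rfl
      rw [List.take_length, hp] at this
      rw [← this]
      unfold wordDist
      simp [mul_assoc]
    omega

/-- The finite type of a word: short suffixes, and relative lengths nearby. -/
def wordType (S : Finset G) (D : ℝ) (C N : ℕ) (w : List {g : G // IsLetter S g}) :
    Prop × Set {l : List {g : G // IsLetter S g} // l.length ≤ C} ×
      Set ({l : List {g : G // IsLetter S g} // l.length ≤ N} × Fin (2 * N + 1)) :=
  (IsContractingWord S D (w.map Subtype.val), {l | l.1 <:+ w},
    {x | wordLength S ((w.map Subtype.val).prod * (x.1.1.map Subtype.val).prod) + N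
      = w.length + x.2})

lemma map_letters {S : Finset G} (w : List {g : G // IsLetter S g}) :
    ∀ x ∈ w.map Subtype.val, IsLetter S x := by
  intro x hx
  obtain ⟨y, -, rfl⟩ := List.mem_map.1 hx
  exact y.2

lemma type_step {S : Finset G} (hS : Subgroup.closure (S : Set G) = ⊤) {D : ℝ}
    (E : ℕ) (hE : ∀ n : ℕ, (n : ℝ) ≤ D ↔ n ≤ E) (w w' u : List {g : G // IsLetter S g})
    (hT : wordType S D (2 * E + 3) (10 * E + 11) w = wordType S D (2 * E + 3) (10 * E + 11) w')
    (hu : IsContractingWord S D ((w ++ u).map Subtype.val)) :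
    IsContractingWord S D ((w' ++ u).map Subtype.val) := by
  simp only [wordType, Prod.mk.injEq] at hT
  obtain ⟨T1, T2, T3⟩ := hT
  induction u using List.reverseRecOn with
  | nil =>
    simp only [List.append_nil] at *
    exact T1 ▸ hu
  | append_singleton v a ih =>
    have hpre : IsContractingWord S D ((w ++ v).map Subtype.val) := by
      refine contr_factor hS (List.IsInfix.map _ ?_) hu
      exact ⟨[], [a], by simp⟩
    have hw : IsContractingWord S D (w.map Subtype.val) := by
      refine contr_factor hS (List.IsInfix.map _ ?_) hu
      exact ⟨[], v ++ [a], by simp⟩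
    have hw' : IsContractingWord S D (w'.map Subtype.val) := T1 ▸ hw
    have hv' := ih hpre
    have hgeo : IsGeodesicWord S ((w' ++ (v ++ [a])).map Subtype.val) := by
      by_contra hng
      obtain ⟨h, hh1, hh2⟩ := shortcut hS E hE (w'.map Subtype.val) (v.map Subtype.val) a.1 a.2
        (by simpa using hv') (by simpa using hng)
      obtain ⟨l, hl, hp, hn⟩ := wl_ex hS h
      lift l to List {g : G // IsLetter S g} using hl
      rw [List.length_map] at hn
      have g1 := hw'.1.2
      rw [List.length_map] at g1
      have z1 := wl_mul hS (w'.map Subtype.val).prod h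
      have z2 := wl_mul hS ((w'.map Subtype.val).prod * h) h⁻¹
      rw [mul_inv_cancel_right, wl_inv hS] at z2
      obtain ⟨k, hk⟩ : ∃ k, k = wordLength S ((w'.map Subtype.val).prod * h) + (10 * E + 11)
        - w'.length := ⟨_, rfl⟩
      have hmem := Set.ext_iff.1 T3 (⟨l, by omega⟩, ⟨k, by omega⟩)
      simp only [Set.mem_ofPred_eq, hp] at hmem
      have hwl := hmem.2 (by omega)
      have hgu := hu.1.2
      simp only [List.map_append, List.prod_append, List.length_append, List.length_map,
        List.map_cons, List.map_nil, List.prod_singleton, List.length_singleton] at hgu hh2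
      have z3 := wl_mul hS ((w.map Subtype.val).prod * h) (h⁻¹ * (v.map Subtype.val).prod * a.1)
      have z4 : (w.map Subtype.val).prod * h * (h⁻¹ * (v.map Subtype.val).prod * a.1)
        = (w.map Subtype.val).prod * ((v.map Subtype.val).prod * a.1) := by group
      rw [z4] at z3
      omega
    refine local_to_global hS hgeo E hE ?_
    intro i j hij hj hlen
    rw [List.length_map] at hj
    -- the factor
    obtain ⟨x, hx⟩ : ∃ x, x = w' ++ (v ++ [a]) := ⟨_, rfl⟩
    rw [← hx] at hj ⊢
    have e1 : x = x.take i ++ (x.drop i).take (j - i) ++ x.drop j := by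
      have e0 : x.take j = x.take i ++ (x.drop i).take (j - i) := by
        have : j = i + (j - i) := by omega
        conv_lhs => rw [this, List.take_add]
      rw [← e0, List.take_append_drop]
    obtain ⟨t, ht⟩ : ∃ t, t = (x.drop i).take (j - i) := ⟨_, rfl⟩
    have htl : t.length = j - i := by rw [ht, List.length_take, List.length_drop]; omega
    have hil : (x.take i).length = i := by rw [List.length_take]; omega
    rw [← ht] at e1
    have htx : t <:+: x := ⟨_, _, e1.symm⟩
    have htc : IsContractingWord S D (t.map Subtype.val) := by
      rw [hx, ← List.append_assoc, List.infix_concat_iff] at htx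
      rcases htx with htx | htx
      · obtain ⟨s, hs⟩ := htx
        rw [List.append_assoc, List.append_eq_append_iff] at hs
        refine contr_factor hS (List.IsInfix.map _ ?_) hu
        rcases hs with ⟨t1, h1, h2⟩ | ⟨t1, h1, h2⟩
        · have hm := Set.ext_iff.1 T2 ⟨t1, by
            have := congrArg List.length h2
            simp only [List.length_append] at this
            omega⟩
          simp only [Set.mem_ofPred_eq] at hm
          obtain ⟨s', hs'⟩ := hm.2 ⟨s, h1.symm⟩
          exact ⟨s', [], by rw [h2, ← hs']; simp⟩
        · exact ⟨w ++ t1, [], by rw [h2]; simp⟩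
      · exact contr_factor hS (List.IsInfix.map _ htx) hv'
    have hgood := ((contr_iff _ _ _).1 htc).2 0 (j - i) (by omega) (by rw [List.length_map]; omega)
    rw [← goodSet_translate_iff S D _ ((x.take i).map Subtype.val).prod,
      ← segVerts_factor _ _ ((x.drop j).map Subtype.val) _ _ (by rw [List.length_map]; omega),
      ← List.map_append, ← List.map_append, ← e1, List.length_map, hil] at hgood
    have : i + (j - i) = j := by omega
    rwa [this] at hgood

end Aux

/-- The language `L_D` over the alphabet `Σ = S ∪ S⁻¹` consisting
of all `D`-contracting geodesic words is a regular language. -/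
theorem contracting_language_isRegular {G : Type} [Group G] (S : Finset G)
    (hS : Subgroup.closure (S : Set G) = ⊤) (D : ℝ) (hD : 0 ≤ D) :
    Language.IsRegular
      ({w : List {g : G // IsLetter S g} |
        IsContractingWord S D (w.map Subtype.val)} : Language {g : G // IsLetter S g}) := by
  have hfin : Finite {g : G // IsLetter S g} := by
    have : {g : G | IsLetter S g}.Finite := by
      have h : {g : G | IsLetter S g} = (S : Set G) ∪ (S : Set G)⁻¹ := by
        ext g; simp [IsLetter]
      rw [h]
      exact S.finite_toSet.union S.finite_toSet.inv
    exact this.to_subtype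
  obtain ⟨E, hE⟩ : ∃ E : ℕ, ∀ n : ℕ, (n : ℝ) ≤ D ↔ n ≤ E :=
    ⟨⌊D⌋₊, fun n => (Nat.le_floor_iff hD).symm⟩
  have f1 : Finite {l : List {g : G // IsLetter S g} // l.length ≤ 2 * E + 3} :=
    (List.finite_length_le _ _).to_subtype
  have f2 : Finite {l : List {g : G // IsLetter S g} // l.length ≤ 10 * E + 11} :=
    (List.finite_length_le _ _).to_subtype
  refine Language.isRegular_iff_finite_range_leftQuotient.2 ?_
  have hfac : Function.FactorsThrough
      (Language.leftQuotient ({w : List {g : G // IsLetter S g} |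
        IsContractingWord S D (w.map Subtype.val)} : Language {g : G // IsLetter S g}))
      (wordType S D (2 * E + 3) (10 * E + 11)) := by
    intro w w' h
    ext u
    exact ⟨type_step hS E hE w w' u h, type_step hS E hE w' w u h.symm⟩
  obtain ⟨F, hF⟩ := (Function.factorsThrough_iff _).1 hfac
  rw [hF]
  exact (Set.finite_range F).subset (Set.range_comp_subset_range _ _)
end

section
/- Let G be a group with finite generating set S, Σ = S ∪ S⁻¹, and fix D ≥ 0. Suppose there is an infinite word a : ℕ → Σ such that every finite prefix (a₀, a₁, …, a_{n−1}) is a D-contracting geodesic word. Then there exist words u, v over Σ with v nonempty such that for every n ∈ ℕ the concatenation u v^n is a D-contracting geodesic word. -/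
section Aux

variable {G : Type} [Group G] {S : Finset G}

theorem aux_wl_le {l : List G} (hl : ∀ x ∈ l, IsLetter S x) :
    wordLength S l.prod ≤ l.length :=
  Nat.sInf_le ⟨l, hl, rfl, rfl⟩

theorem aux_letter_inv {x : G} (hx : IsLetter S x) : IsLetter S x⁻¹ := by
  rcases hx with h | h
  · right; simpa using h
  · left; exact h

theorem aux_wl_exists (hS : Subgroup.closure (S : Set G) = ⊤) (g : G) :
    ∃ l : List G, (∀ x ∈ l, IsLetter S x) ∧ l.prod = g ∧ l.length = wordLength S g := by
  have hne : {n | ∃ l : List G, (∀ x ∈ l, IsLetter S x) ∧ l.prod = g ∧ l.length = n}.Nonempty := by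
    have hg : g ∈ Subgroup.closure (S : Set G) := by rw [hS]; trivial
    rw [← Subgroup.mem_toSubmonoid, Subgroup.closure_toSubmonoid] at hg
    obtain ⟨l, hl, hp⟩ := Submonoid.exists_list_of_mem_closure hg
    exact ⟨l.length, l, fun x hx => by simpa [IsLetter] using hl x hx, hp, rfl⟩
  exact Nat.sInf_mem hne

theorem aux_wl_mul (hS : Subgroup.closure (S : Set G) = ⊤) (g h : G) :
    wordLength S (g * h) ≤ wordLength S g + wordLength S h := by
  obtain ⟨l, hl, hp, hn⟩ := aux_wl_exists hS g
  obtain ⟨l', hl', hp', hn'⟩ := aux_wl_exists hS h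
  have := aux_wl_le (S := S) (l := l ++ l') (by
    intro x hx
    rcases List.mem_append.1 hx with h | h
    · exact hl x h
    · exact hl' x h)
  rw [List.prod_append, List.length_append, hp, hp', hn, hn'] at this
  exact this

theorem aux_wl_one : wordLength S (1 : G) = 0 := by
  have := aux_wl_le (S := S) (l := ([] : List G)) (by simp)
  simpa using this

theorem aux_wl_inv_le (hS : Subgroup.closure (S : Set G) = ⊤) (g : G) :
    wordLength S g⁻¹ ≤ wordLength S g := by
  obtain ⟨l, hl, hp, hn⟩ := aux_wl_exists hS g
  have := aux_wl_le (S := S) (l := (l.map (·⁻¹)).reverse) (by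
    intro x hx
    simp only [List.mem_reverse, List.mem_map] at hx
    obtain ⟨y, hy, rfl⟩ := hx
    exact aux_letter_inv (hl y hy))
  rw [← List.prod_inv_reverse, hp] at this
  simpa [hn] using this

theorem aux_wl_inv (hS : Subgroup.closure (S : Set G) = ⊤) (g : G) :
    wordLength S g⁻¹ = wordLength S g := by
  apply le_antisymm (aux_wl_inv_le hS g)
  simpa using aux_wl_inv_le hS g⁻¹

theorem aux_d_comm (hS : Subgroup.closure (S : Set G) = ⊤) (g h : G) :
    wordDist S g h = wordDist S h g := by
  unfold wordDist
  rw [← aux_wl_inv hS]; simp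

theorem aux_d_tri (hS : Subgroup.closure (S : Set G) = ⊤) (g h k : G) :
    wordDist S g k ≤ wordDist S g h + wordDist S h k := by
  unfold wordDist
  have := aux_wl_mul hS (g⁻¹ * h) (h⁻¹ * k)
  simpa [mul_assoc] using this

theorem aux_d_self (g : G) : wordDist S g g = 0 := by
  simp [wordDist, aux_wl_one]

theorem aux_d_left (c g h : G) : wordDist S (c * g) (c * h) = wordDist S g h := by
  simp [wordDist, mul_assoc]

theorem aux_d_eq_zero (hS : Subgroup.closure (S : Set G) = ⊤) {g h : G}
    (h0 : wordDist S g h = 0) : g = h := by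
  obtain ⟨l, hl, hp, hn⟩ := aux_wl_exists hS (g⁻¹ * h)
  have : l.length = 0 := by rw [hn]; exact h0
  have : l = [] := List.length_eq_zero_iff.1 this
  subst this
  simp only [List.prod_nil] at hp
  exact (inv_mul_eq_one.1 hp.symm)

/-- points on geodesics -/
theorem aux_geo_pt (hS : Subgroup.closure (S : Set G) = ⊤) (x q : G) (t : ℕ)
    (ht : t ≤ wordDist S x q) :
    ∃ y, wordDist S x y = t ∧ t + wordDist S y q = wordDist S x q := by
  obtain ⟨l, hl, hp, hn⟩ := aux_wl_exists hS (x⁻¹ * q)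
  have hn' : l.length = wordDist S x q := hn
  refine ⟨x * (l.take t).prod, ?_⟩
  have h1 : wordDist S x (x * (l.take t).prod) ≤ t := by
    have := aux_wl_le (S := S) (l := l.take t) (fun y hy => hl y (List.mem_of_mem_take hy))
    simp only [wordDist, inv_mul_cancel_left]
    simp only [List.length_take] at this
    omega
  have h2 : wordDist S (x * (l.take t).prod) q ≤ l.length - t := by
    have := aux_wl_le (S := S) (l := l.drop t) (fun y hy => hl y (List.mem_of_mem_drop hy))
    have e : (x * (l.take t).prod)⁻¹ * q = (l.drop t).prod := by
      have := List.prod_take_mul_prod_drop l t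
      rw [hp] at this
      rw [mul_inv_rev, mul_assoc, ← this, inv_mul_cancel_left]
    simp only [wordDist, e]
    simpa using this
  have h3 := aux_d_tri hS x (x * (l.take t).prod) q
  omega

theorem aux_proj_exists (P : Set G) (hP : P.Nonempty) (x : G) :
    ∃ p, p ∈ projPt S P x := by
  have hne : {n | ∃ p ∈ P, wordDist S x p = n}.Nonempty := by
    obtain ⟨p, hp⟩ := hP
    exact ⟨_, p, hp, rfl⟩
  obtain ⟨p, hp, h⟩ := Nat.sInf_mem hne
  exact ⟨p, hp, fun q hq => by rw [h]; exact Nat.sInf_le ⟨q, hq, rfl⟩⟩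

/-- `E`-contracting sets. -/
def AuxEC (S : Finset G) (E : ℕ) (P : Set G) : Prop :=
  ∀ g₀ : G, ∀ r : ℕ, (∀ h, wordDist S g₀ h ≤ r → h ∉ P) →
    ∀ b₁ b₂ p q : G, wordDist S g₀ b₁ ≤ r → wordDist S g₀ b₂ ≤ r →
      p ∈ projPt S P b₁ → q ∈ projPt S P b₂ → wordDist S p q ≤ E

theorem aux_contr_iff (D : ℝ) (hD : 0 ≤ D) (w : List G) :
    IsContractingWord S D w ↔ IsGeodesicWord S w ∧
      ∀ i j : ℕ, i ≤ j → j ≤ w.length → AuxEC S ⌊D⌋₊ (segVerts w i j) := by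
  unfold IsContractingWord
  refine and_congr_right fun _ => ?_
  constructor
  · intro h i j hij hj g₀ r hd b₁ b₂ p q h1 h2 hp hq
    rw [Nat.le_floor_iff hD]
    refine h i j hij hj g₀ r (Set.disjoint_left.2 hd) p ?_ q ?_
    · exact Set.mem_biUnion (show b₁ ∈ wordBall S g₀ r from h1) hp
    · exact Set.mem_biUnion (show b₂ ∈ wordBall S g₀ r from h2) hq
  · intro h i j hij hj g₀ r hd p hp q hq
    rw [← Nat.le_floor_iff hD]
    simp only [projSet, Set.mem_iUnion] at hp hq
    obtain ⟨b₁, h1, hp⟩ := hp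
    obtain ⟨b₂, h2, hq⟩ := hq
    exact h i j hij hj g₀ r (fun x hx => Set.disjoint_left.1 hd hx) b₁ b₂ p q h1 h2 hp hq

theorem aux_EC_smul {E : ℕ} {P Q : Set G} (c : G) (hPQ : ∀ x, x ∈ P ↔ c * x ∈ Q)
    (h : AuxEC S E P) : AuxEC S E Q := by
  have key : ∀ b p, p ∈ projPt S Q b → c⁻¹ * p ∈ projPt S P (c⁻¹ * b) := by
    intro b p hp
    refine ⟨(hPQ _).2 (by simpa using hp.1), fun q hq => ?_⟩
    have := hp.2 (c * q) ((hPQ q).1 hq)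
    rw [aux_d_left]
    rw [← aux_d_left c (c⁻¹ * b) q]
    simpa using this
  intro g₀ r hd b₁ b₂ p q h1 h2 hp hq
  rw [← aux_d_left c⁻¹ p q]
  refine h (c⁻¹ * g₀) r ?_ (c⁻¹ * b₁) (c⁻¹ * b₂) _ _ ?_ ?_ (key _ _ hp) (key _ _ hq)
  · intro x hx hxP
    refine hd (c * x) ?_ ((hPQ x).1 hxP)
    rw [← aux_d_left c] at hx
    simpa using hx
  · rwa [aux_d_left]
  · rwa [aux_d_left]

/-- Lemma A: projections are coarse gates. -/
theorem aux_gate (hS : Subgroup.closure (S : Set G) = ⊤) {E : ℕ} {P : Set G}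
    (hP : AuxEC S E P) : ∀ n : ℕ, ∀ x q p : G, wordDist S x q = n → q ∈ P →
      p ∈ projPt S P x → wordDist S x p + wordDist S p q ≤ wordDist S x q + (2 * E + 2) := by
  intro n
  induction n using Nat.strong_induction_on with
  | _ n ih =>
    intro x q p hn hq hp
    have hR : wordDist S x p ≤ wordDist S x q := hp.2 q hq
    have t1 := aux_d_tri hS p x q
    rw [aux_d_comm hS p x] at t1
    by_cases hR1 : wordDist S x p ≤ 1
    · omega
    obtain ⟨y, hy1, hy2⟩ := aux_geo_pt hS x q (wordDist S x p - 1) (by omega)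
    obtain ⟨p', hp'⟩ := aux_proj_exists (S := S) P ⟨q, hq⟩ y
    have hpp : wordDist S p p' ≤ E := by
      refine hP x (wordDist S x p - 1) ?_ x y p p' ?_ (by omega) hp hp'
      · intro h hh hhP
        have := hp.2 h hhP
        omega
      · rw [aux_d_self]; omega
    have t2 := aux_d_tri hS p p' q
    by_cases hc : E + 1 ≤ wordDist S y p'
    · have := ih (wordDist S y q) (by omega) y q p' rfl hq hp'
      omega
    · have t3 := aux_d_tri hS p' y q
      rw [aux_d_comm hS p' y] at t3
      omega

theorem aux_take_le {w : List G} (hw : ∀ x ∈ w, IsLetter S x) {i j : ℕ} (hij : i ≤ j) :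
    wordDist S (w.take i).prod (w.take j).prod ≤ j - i := by
  have e : ((w.take i).prod)⁻¹ * (w.take j).prod = ((w.take j).drop i).prod := by
    have := List.prod_take_mul_prod_drop (w.take j) i
    rw [List.take_take, min_eq_left hij] at this
    rw [← this]; simp
  unfold wordDist
  rw [e]
  refine (aux_wl_le fun x hx => hw x (List.mem_of_mem_take (List.mem_of_mem_drop hx))).trans ?_
  simp only [List.length_drop, List.length_take]
  omega

theorem aux_geo_dist (hS : Subgroup.closure (S : Set G) = ⊤) {w : List G}
    (hw : IsGeodesicWord S w) {i j : ℕ} (hij : i ≤ j) (hj : j ≤ w.length) :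
    wordDist S (w.take i).prod (w.take j).prod = j - i := by
  have h1 := aux_take_le hw.1 hij
  have h2 := aux_take_le hw.1 (Nat.zero_le i)
  have h3 := aux_take_le hw.1 hj
  have h4 := aux_d_tri hS (w.take 0).prod (w.take i).prod (w.take w.length).prod
  have h5 := aux_d_tri hS (w.take i).prod (w.take j).prod (w.take w.length).prod
  have h6 : wordDist S (w.take 0).prod (w.take w.length).prod = w.length := by
    simp [wordDist, hw.2]
  omega

theorem aux_seg_append (a b : List G) (i j : ℕ) (x : G) :
    x ∈ segVerts b i j ↔ a.prod * x ∈ segVerts (a ++ b) (a.length + i) (a.length + j) := by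
  constructor
  · rintro ⟨k, h1, h2, rfl⟩
    refine ⟨a.length + k, by omega, by omega, ?_⟩
    rw [List.take_length_add_append, List.prod_append]
  · rintro ⟨k, h1, h2, h3⟩
    obtain ⟨k', rfl⟩ := Nat.exists_eq_add_of_le (show a.length ≤ k by omega)
    refine ⟨k', by omega, by omega, ?_⟩
    rw [List.take_length_add_append, List.prod_append] at h3
    exact mul_left_cancel h3

theorem aux_seg_prefix (a b : List G) (i j : ℕ) (hj : j ≤ a.length) :
    segVerts (a ++ b) i j = segVerts a i j := by
  ext x
  constructor
  · rintro ⟨k, h1, h2, h3⟩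
    exact ⟨k, h1, h2, by rw [← h3, List.take_append_of_le_length (by omega)]⟩
  · rintro ⟨k, h1, h2, h3⟩
    exact ⟨k, h1, h2, by rw [← h3, List.take_append_of_le_length (by omega)]⟩

/-- contracting words, natural number version -/
def AuxC (S : Finset G) (E : ℕ) (w : List G) : Prop :=
  IsGeodesicWord S w ∧ ∀ i j : ℕ, i ≤ j → j ≤ w.length → AuxEC S E (segVerts w i j)

theorem aux_C_prefix (hS : Subgroup.closure (S : Set G) = ⊤) {E : ℕ} {a b : List G}
    (h : AuxC S E (a ++ b)) : AuxC S E a := by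
  have hl : ∀ x ∈ a, IsLetter S x := fun x hx => h.1.1 x (by simp [hx])
  have hl' : ∀ x ∈ b, IsLetter S x := fun x hx => h.1.1 x (by simp [hx])
  refine ⟨⟨hl, ?_⟩, ?_⟩
  · have h1 := aux_wl_le hl
    have h2 := aux_wl_le hl'
    have h3 := h.1.2
    have h4 := aux_wl_mul hS a.prod b.prod
    rw [List.prod_append, List.length_append] at h3
    omega
  · intro i j hij hj
    have := h.2 i j hij (by rw [List.length_append]; omega)
    rwa [aux_seg_prefix _ _ _ _ hj] at this

theorem aux_proj_sub {P Q : Set G} (hPQ : Q ⊆ P) {b p : G} (hp : p ∈ projPt S P b) (hQ : p ∈ Q) :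
    p ∈ projPt S Q b := ⟨hQ, fun q hq => hp.2 q (hPQ hq)⟩

theorem aux_bound (hS : Subgroup.closure (S : Set G) = ⊤) {E : ℕ} {W W' : List G} {s : G}
    (hW' : W' = W ++ [s]) (hW : AuxC S E W) (hg : IsGeodesicWord S W')
    (hshort : ∀ k, k ≤ W'.length → W'.length ≤ k + (3 * E + 4) →
      AuxEC S E (segVerts W' k W'.length))
    (i : ℕ) (hi : i ≤ W.length) (g₀ : G) (r : ℕ)
    (hd : ∀ h, wordDist S g₀ h ≤ r → h ∉ segVerts W' i W'.length)
    (b₁ b₂ p : G) (hb₁ : wordDist S g₀ b₁ ≤ r) (hb₂ : wordDist S g₀ b₂ ≤ r)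
    (hp : p ∈ projPt S (segVerts W' i W'.length) b₁)
    (hq : W'.prod ∈ projPt S (segVerts W' i W'.length) b₂)
    (hpW : p ∈ segVerts W i W.length) :
    wordDist S p W'.prod ≤ E := by
  have hlen : W'.length = W.length + 1 := by simp [hW']
  have hsub : segVerts W i W.length ⊆ segVerts W' i W'.length := by
    rintro x ⟨k, h1, h2, rfl⟩
    refine ⟨k, h1, by omega, ?_⟩
    rw [hW', List.take_append_of_le_length h2]
  have hEC := hW.2 i W.length hi le_rfl
  have hprev : W.prod ∈ segVerts W i W.length := ⟨W.length, hi, le_rfl, by simp⟩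
  obtain ⟨q', hq'⟩ := aux_proj_exists (S := S) (segVerts W i W.length) ⟨_, hprev⟩ b₂
  have h1 : wordDist S p q' ≤ E :=
    hEC g₀ r (fun h hh hm => hd h hh (hsub hm)) b₁ b₂ p q' hb₁ hb₂ (aux_proj_sub hsub hp hpW) hq'
  have h2 := aux_gate hS hEC _ b₂ W.prod q' rfl hprev hq'
  have h3 := hq.2 q' (hsub hq'.1)
  have h4 := aux_d_tri hS b₂ W'.prod W.prod
  have h5 : wordDist S W.prod W'.prod ≤ 1 := by
    have := aux_take_le hg.1 (show W.length ≤ W'.length by omega)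
    rw [List.take_length] at this
    rw [hW', List.take_left, ← hW'] at this
    omega
  rw [aux_d_comm hS] at h5
  have h6 := aux_d_tri hS p q' W.prod
  have h7 := aux_d_tri hS p W.prod W'.prod
  rw [aux_d_comm hS W.prod W'.prod] at h7
  obtain ⟨k, hk1, hk2, hk3⟩ := hp.1
  have h8 := aux_geo_dist hS hg hk2 le_rfl
  rw [hk3, List.take_length] at h8
  have hsub2 : segVerts W' k W'.length ⊆ segVerts W' i W'.length := by
    rintro x ⟨l, h1, h2, rfl⟩
    exact ⟨l, by omega, h2, rfl⟩
  refine hshort k hk2 (by omega) g₀ r (fun h hh hm => hd h hh (hsub2 hm)) b₁ b₂ p _ hb₁ hb₂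
    (aux_proj_sub hsub2 hp ⟨k, le_rfl, hk2, hk3⟩)
    (aux_proj_sub hsub2 hq ⟨W'.length, hk2, le_rfl, by simp⟩)

theorem aux_extend (hS : Subgroup.closure (S : Set G) = ⊤) {E : ℕ} {W W' : List G} {s : G}
    (hW' : W' = W ++ [s]) (hW : AuxC S E W) (hg : IsGeodesicWord S W')
    (hshort : ∀ k, k ≤ W'.length → W'.length ≤ k + (3 * E + 4) →
      AuxEC S E (segVerts W' k W'.length)) : AuxC S E W' := by
  refine ⟨hg, fun i j hij hj => ?_⟩
  have hlen : W'.length = W.length + 1 := by simp [hW']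
  by_cases hjW : j ≤ W.length
  · rw [hW', aux_seg_prefix _ _ _ _ hjW]
    exact hW.2 i j hij hjW
  obtain rfl : j = W'.length := by omega
  by_cases hi : i = W'.length
  · exact hshort i hij (by omega)
  have hiW : i ≤ W.length := by omega
  have hcase : ∀ x ∈ segVerts W' i W'.length, x = W'.prod ∨ x ∈ segVerts W i W.length := by
    rintro x ⟨k, h1, h2, rfl⟩
    by_cases hk : k ≤ W.length
    · right
      exact ⟨k, h1, hk, by rw [hW', List.take_append_of_le_length hk]⟩
    · left
      obtain rfl : k = W'.length := by omega
      simp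
  have hsub : segVerts W i W.length ⊆ segVerts W' i W'.length := by
    rintro x ⟨k, h1, h2, rfl⟩
    refine ⟨k, h1, by omega, ?_⟩
    rw [hW', List.take_append_of_le_length h2]
  intro g₀ r hd b₁ b₂ p q hb₁ hb₂ hp hq
  rcases hcase p hp.1 with rfl | hp'
  · rcases hcase q hq.1 with rfl | hq'
    · rw [aux_d_self]; omega
    · rw [aux_d_comm hS]
      exact aux_bound hS hW' hW hg hshort i hiW g₀ r hd b₂ b₁ q hb₂ hb₁ hq hp hq'
  · rcases hcase q hq.1 with rfl | hq'
    · exact aux_bound hS hW' hW hg hshort i hiW g₀ r hd b₁ b₂ p hb₁ hb₂ hp hq hp'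
    · exact hW.2 i W.length hiW le_rfl g₀ r (fun h hh hm => hd h hh (hsub hm)) b₁ b₂ p q hb₁ hb₂
        (aux_proj_sub hsub hp hp') (aux_proj_sub hsub hq hq')

theorem aux_geo_extend (hS : Subgroup.closure (S : Set G) = ⊤) {E : ℕ} {u u' x : List G} {s : G}
    (hu : u' ≠ [])
    (htype : ∀ g, wordLength S g ≤ 4 * E + 6 →
      wordLength S (u'.prod * g) + 1 = u'.length → wordLength S (u.prod * g) + 1 = u.length)
    (hW : AuxC S E (u' ++ x)) (hg : IsGeodesicWord S (u ++ (x ++ [s]))) :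
    IsGeodesicWord S (u' ++ (x ++ [s])) := by
  have hpos : 0 < u'.length := List.length_pos_iff.2 hu
  have hl : ∀ y ∈ u' ++ (x ++ [s]), IsLetter S y := by
    intro y hy
    rcases List.mem_append.1 hy with h | h
    · exact hW.1.1 y (by simp [h])
    · exact hg.1 y (List.mem_append_right _ h)
  refine ⟨hl, ?_⟩
  by_contra hne
  have hle := aux_wl_le hl
  have hu' := (aux_C_prefix hS hW).1
  set e := (u' ++ (x ++ [s])).prod with he
  set f := (u' ++ x).prod with hf
  have hlen1 : (u' ++ (x ++ [s])).length = u'.length + x.length + 1 := by simp; omega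
  have hlen2 : (u' ++ x).length = u'.length + x.length := by simp
  have hfe : wordDist S e f ≤ 1 := by
    rw [aux_d_comm hS]
    have h := aux_wl_le (S := S) (l := [s]) (by
      intro y hy; exact hl y (by simp at hy; simp [hy]))
    have : f⁻¹ * e = [s].prod := by
      rw [he, hf, ← List.append_assoc, List.prod_append (l₁ := u' ++ x),
        inv_mul_cancel_left]
    unfold wordDist
    rw [this]; simpa using h
  have hflen : wordDist S 1 f = u'.length + x.length := by
    simp only [wordDist, inv_one, one_mul]; rw [hW.1.2, hlen2]
  have helen : wordDist S 1 e ≤ u'.length + x.length := by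
    simp only [wordDist, inv_one, one_mul]; omega
  have t1 := aux_d_tri hS 1 e f
  obtain ⟨h, hh1, hh2⟩ := aux_geo_pt hS 1 e (u'.length - 1) (by omega)
  have hEC := hW.2 0 (u' ++ x).length (Nat.zero_le _) le_rfl
  have m1 : (1 : G) ∈ segVerts (u' ++ x) 0 (u' ++ x).length := ⟨0, le_rfl, Nat.zero_le _, by simp⟩
  have m2 : f ∈ segVerts (u' ++ x) 0 (u' ++ x).length :=
    ⟨_, Nat.zero_le _, le_rfl, by rw [List.take_length]⟩
  obtain ⟨p, hp⟩ := aux_proj_exists (S := S) _ ⟨_, m1⟩ h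
  have g1 := aux_gate hS hEC _ h 1 p rfl m1 hp
  have g2 := aux_gate hS hEC _ h f p rfl m2 hp
  have t2 := aux_d_tri hS 1 p f
  have t3 := aux_d_tri hS h e f
  have c1 := aux_d_comm hS h 1
  have c2 := aux_d_comm hS p 1
  have c3 := aux_d_comm hS p h
  have t4 := aux_d_tri hS 1 h p
  have t5 := aux_d_tri hS 1 p h
  obtain ⟨k, -, hk2, hk3⟩ := hp.1
  have d1 : wordDist S 1 p = k := by
    have := aux_geo_dist hS hW.1 (Nat.zero_le k) hk2
    rw [hk3] at this; simpa using this
  have htk : ((u' ++ x).take u'.length).prod = u'.prod := by rw [List.take_left]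
  have d2 : wordDist S u'.prod p ≤ wordDist S h p + 1 := by
    rcases le_total k u'.length with hk | hk
    · have := aux_geo_dist hS hW.1 hk (by omega)
      rw [hk3, htk, aux_d_comm hS] at this
      omega
    · have := aux_geo_dist hS hW.1 hk hk2
      rw [hk3, htk] at this
      omega
  have t6 := aux_d_tri hS u'.prod p h
  have key := htype (u'.prod⁻¹ * h) (by
    change wordDist S u'.prod h ≤ _
    omega) (by
    simp only [wordDist, inv_one, one_mul] at hh1
    rw [mul_inv_cancel_left]; omega)
  have fin := aux_wl_mul hS (u.prod * (u'.prod⁻¹ * h)) (h⁻¹ * e)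
  have e1 : u.prod * (u'.prod⁻¹ * h) * (h⁻¹ * e) = (u ++ (x ++ [s])).prod := by
    rw [he, List.prod_append, List.prod_append (l₁ := u)]; group
  rw [e1, hg.2] at fin
  have e2 : wordLength S (h⁻¹ * e) = wordDist S h e := rfl
  have hlen3 : (u ++ (x ++ [s])).length = u.length + x.length + 1 := by simp; omega
  omega

theorem aux_cone (hS : Subgroup.closure (S : Set G) = ⊤) {E : ℕ} {u₁ u₁' t : List G}
    (ht : t.length = 3 * E + 4)
    (htype : ∀ g, wordLength S g ≤ 4 * E + 6 →
      wordLength S ((u₁' ++ t).prod * g) + 1 = (u₁' ++ t).length →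
      wordLength S ((u₁ ++ t).prod * g) + 1 = (u₁ ++ t).length)
    (hu' : AuxC S E (u₁' ++ t)) (x : List G) :
    AuxC S E (u₁ ++ t ++ x) → AuxC S E (u₁' ++ t ++ x) := by
  induction x using List.reverseRecOn with
  | nil => intro _; simpa using hu'
  | append_singleton x s ih =>
    intro h
    have hW : AuxC S E (u₁' ++ t ++ x) := by
      apply ih
      rw [← List.append_assoc] at h
      exact aux_C_prefix hS h
    have hne : u₁' ++ t ≠ [] := by
      intro h0
      have := congrArg List.length h0
      simp at this
      rw [this.2] at ht
      simp at ht
    refine aux_extend hS (W := u₁' ++ t ++ x) (s := s) (by simp) hW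
      (aux_geo_extend hS hne htype hW h.1) ?_
    intro k hk1 hk2
    simp only [List.append_assoc] at h hk1 hk2 ⊢
    set T := t ++ (x ++ [s]) with hT
    have hTl : T.length = 3 * E + 4 + x.length + 1 := by simp [hT, ht]; omega
    rw [List.length_append] at hk1 hk2
    obtain ⟨k', rfl⟩ := Nat.exists_eq_add_of_le (show u₁'.length ≤ k by omega)
    rw [List.length_append]
    refine aux_EC_smul u₁'.prod (aux_seg_append u₁' T k' T.length) ?_
    have h2 := h.2 (u₁.length + k') (u₁.length + T.length) (by omega) (by simp)
    refine aux_EC_smul u₁.prod⁻¹ (fun y => ?_) h2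
    rw [aux_seg_append u₁ T k' T.length, mul_inv_cancel_left]

theorem aux_ball_finite (hS : Subgroup.closure (S : Set G) = ⊤) (k : ℕ) :
    {g : G | wordLength S g ≤ k}.Finite := by
  have hA : {g : G | IsLetter S g}.Finite := by
    have : {g : G | IsLetter S g} = (S : Set G) ∪ (S : Set G)⁻¹ := by
      ext g; simp [IsLetter]
    rw [this]
    exact S.finite_toSet.union S.finite_toSet.inv
  have : Finite {g : G // IsLetter S g} := hA
  have hL : {l : List {g : G // IsLetter S g} | l.length ≤ k}.Finite := List.finite_length_le _ k
  refine (hL.image fun l => (l.map Subtype.val).prod).subset ?_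
  intro g hg
  obtain ⟨l, hl, hp, hn⟩ := aux_wl_exists hS g
  refine ⟨l.attachWith _ hl, ?_, ?_⟩
  · simp only [Set.mem_ofPred_eq, List.length_attachWith]
    rw [hn]; exact hg
  · simp [hp]

end Aux

theorem exists_contracting_periodic_ray {G : Type} [Group G] (S : Finset G)
    (hS : Subgroup.closure (S : Set G) = ⊤) (D : ℝ) (hD : 0 ≤ D)
    (a : ℕ → G) (ha : ∀ i, IsLetter S (a i))
    (hpref : ∀ n : ℕ, IsContractingWord S D (List.ofFn (fun i : Fin n => a i))) :
    ∃ u v : List G, (∀ x ∈ u, IsLetter S x) ∧ (∀ x ∈ v, IsLetter S x) ∧ v ≠ [] ∧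
      ∀ n : ℕ, IsContractingWord S D (u ++ (List.replicate n v).flatten) := by
  set E := ⌊D⌋₊ with hE
  have hC : ∀ w, IsContractingWord S D w ↔ AuxC S E w := fun w => aux_contr_iff D hD w
  simp only [hC] at hpref ⊢
  -- segments of the ray
  have hsplit : ∀ m n : ℕ, List.ofFn (fun i : Fin (m + n) => a i) =
      List.ofFn (fun i : Fin m => a i) ++ List.ofFn (fun i : Fin n => a (m + i)) := by
    intro m n
    rw [List.ofFn_add]; simp
  have hB := aux_ball_finite hS (4 * E + 6)
  have hA : {g : G | IsLetter S g}.Finite := by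
    have : {g : G | IsLetter S g} = (S : Set G) ∪ (S : Set G)⁻¹ := by
      ext g; simp [IsLetter]
    rw [this]
    exact S.finite_toSet.union S.finite_toSet.inv
  have : Finite {g : G // IsLetter S g} := hA
  have : Finite {g : G // wordLength S g ≤ 4 * E + 6} := hB
  let W : ℕ → List G := fun n => List.ofFn (fun i : Fin n => a i)
  let F : ℕ → Set {g : G // wordLength S g ≤ 4 * E + 6} ×
      (Fin (3 * E + 4) → {g : G // IsLetter S g}) := fun n =>
    ({g | wordLength S ((W (n + (3 * E + 4))).prod * g.1) + 1 = (W (n + (3 * E + 4))).length},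
      fun i => ⟨a (n + i), ha _⟩)
  obtain ⟨m, n, hmn, hF⟩ : ∃ m n, m < n ∧ F m = F n := by
    obtain ⟨m, n, hne, h⟩ := Finite.exists_ne_map_eq_of_infinite F
    rcases lt_or_gt_of_ne hne with h1 | h1
    · exact ⟨m, n, h1, h⟩
    · exact ⟨n, m, h1, h.symm⟩
  have hF1 := congrArg Prod.fst hF
  have hF2 := congrArg Prod.snd hF
  set t : List G := List.ofFn (fun i : Fin (3 * E + 4) => a (m + i)) with ht
  have ht' : t = List.ofFn (fun i : Fin (3 * E + 4) => a (n + i)) := by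
    rw [ht]
    congr 1
    funext i
    exact congrArg Subtype.val (congrFun hF2 i)
  have hWm : W (m + (3 * E + 4)) = W m ++ t := hsplit _ _
  have hWn : W (n + (3 * E + 4)) = W n ++ t := by rw [ht']; exact hsplit _ _
  set v : List G := List.ofFn (fun i : Fin (n - m) => a (m + (3 * E + 4) + i)) with hv
  have hWnv : W n ++ t = W m ++ t ++ v := by
    rw [← hWm, ← hWn, hv]
    have := hsplit (m + (3 * E + 4)) (n - m)
    rw [← this]
    have e : n + (3 * E + 4) = m + (3 * E + 4) + (n - m) := by omega
    show W _ = W _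
    rw [e]
  have cone := aux_cone hS (E := E) (u₁ := W m) (u₁' := W n) (t := t) (by simp [ht])
    (by
      intro g hg h
      rw [← hWm]
      rw [← hWn] at h
      have : (⟨g, hg⟩ : {g : G // wordLength S g ≤ 4 * E + 6}) ∈ (F n).1 := h
      rw [← hF1] at this
      exact this)
    (by rw [← hWn]; exact hpref _)
  refine ⟨W m ++ t, v, ?_, ?_, ?_, ?_⟩
  · rw [← hWm]; exact (hpref _).1.1
  · intro x hx
    rw [hv, List.mem_ofFn] at hx
    obtain ⟨i, rfl⟩ := hx
    exact ha _
  · intro h0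
    have := congrArg List.length h0
    simp [hv] at this
    omega
  · intro k
    induction k with
    | zero => simpa [← hWm] using hpref _
    | succ k ih =>
      have := cone _ ih
      rw [hWnv] at this
      simpa [List.replicate_succ] using this
end

section
/- Let G be a group with finite generating set S, Σ = S ∪ S⁻¹, and fix D ≥ 0. For each n ∈ ℕ let b_n denote the number of D-contracting geodesic words over Σ of length at most n. Then (b_n) satisfies a linear recursion: there exist k ≥ 1 and integers c₁, …, c_k such that b_{n+k} = c₁·b_{n+k−1} + ⋯ + c_k·b_n for all n ∈ ℕ. -/
namespace CGr

variable {G : Type} [Group G] (S : Finset G)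

theorem IsLetter.inv' {S : Finset G} {g : G} (h : IsLetter S g) : IsLetter S g⁻¹ := by
  unfold IsLetter at *
  rw [inv_inv]
  exact h.symm

theorem wl_le {l : List G} (hl : ∀ x ∈ l, IsLetter S x) : wordLength S l.prod ≤ l.length :=
  Nat.sInf_le ⟨l, hl, rfl, rfl⟩

theorem wl_exists (hS : Subgroup.closure (S : Set G) = ⊤) (g : G) :
    ∃ l : List G, (∀ x ∈ l, IsLetter S x) ∧ l.prod = g ∧ l.length = wordLength S g := by
  have hne : {n | ∃ l : List G, (∀ x ∈ l, IsLetter S x) ∧ l.prod = g ∧ l.length = n}.Nonempty := by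
    have hg : g ∈ Subgroup.closure (S : Set G) := by rw [hS]; trivial
    rw [← Subgroup.mem_toSubmonoid, Subgroup.closure_toSubmonoid] at hg
    obtain ⟨l, hl, hp⟩ := Submonoid.exists_list_of_mem_closure hg
    exact ⟨l.length, l, fun x hx => by simpa [IsLetter] using hl x hx, hp, rfl⟩
  exact Nat.sInf_mem hne

theorem wl_mul (hS : Subgroup.closure (S : Set G) = ⊤) (g h : G) :
    wordLength S (g * h) ≤ wordLength S g + wordLength S h := by
  obtain ⟨l, hl, hp, hn⟩ := wl_exists S hS g
  obtain ⟨l', hl', hp', hn'⟩ := wl_exists S hS h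
  have := wl_le S (l := l ++ l') (by
    intro x hx
    rcases List.mem_append.1 hx with hx | hx
    · exact hl x hx
    · exact hl' x hx)
  rw [List.prod_append, hp, hp', List.length_append, hn, hn'] at this
  exact this

theorem wl_inv_le (hS : Subgroup.closure (S : Set G) = ⊤) (g : G) :
    wordLength S g⁻¹ ≤ wordLength S g := by
  obtain ⟨l, hl, hp, hn⟩ := wl_exists S hS g
  have := wl_le S (l := (l.map fun x => x⁻¹).reverse) (by
    intro x hx
    simp only [List.mem_reverse, List.mem_map] at hx
    obtain ⟨y, hy, rfl⟩ := hx
    exact IsLetter.inv' (hl y hy))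
  rw [← List.prod_inv_reverse, hp] at this
  simpa [hn] using this

theorem wl_inv (hS : Subgroup.closure (S : Set G) = ⊤) (g : G) :
    wordLength S g⁻¹ = wordLength S g := by
  apply le_antisymm (wl_inv_le S hS g)
  simpa using wl_inv_le S hS g⁻¹

theorem wl_one : wordLength S (1 : G) = 0 := by
  have := wl_le S (l := []) (by simp)
  simpa using this

theorem wl_zero (hS : Subgroup.closure (S : Set G) = ⊤) {g : G} (h : wordLength S g = 0) :
    g = 1 := by
  obtain ⟨l, hl, hp, hn⟩ := wl_exists S hS g
  rw [h] at hn
  rw [List.length_eq_zero_iff.1 hn] at hp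
  simpa using hp.symm

theorem wl_letter {a : G} (ha : IsLetter S a) : wordLength S a ≤ 1 := by
  have := wl_le S (l := [a]) (by simpa using ha)
  simpa using this

theorem d_self (g : G) : wordDist S g g = 0 := by simp [wordDist, wl_one]

theorem d_zero (hS : Subgroup.closure (S : Set G) = ⊤) {g h : G} (H : wordDist S g h = 0) :
    g = h := by
  have := wl_zero S hS H
  exact (inv_mul_eq_one.1 this)

theorem d_comm (hS : Subgroup.closure (S : Set G) = ⊤) (g h : G) :
    wordDist S g h = wordDist S h g := by
  unfold wordDist
  rw [← wl_inv S hS]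
  simp

theorem d_tri (hS : Subgroup.closure (S : Set G) = ⊤) (g h k : G) :
    wordDist S g k ≤ wordDist S g h + wordDist S h k := by
  unfold wordDist
  have := wl_mul S hS (g⁻¹ * h) (h⁻¹ * k)
  simpa [mul_assoc] using this

theorem d_mul (x g h : G) : wordDist S (x * g) (x * h) = wordDist S g h := by
  unfold wordDist
  congr 1
  group

theorem d_split (hS : Subgroup.closure (S : Set G) = ⊤) (x y : G) (t : ℕ)
    (ht : t ≤ wordDist S x y) :
    ∃ z, wordDist S x z = t ∧ wordDist S z y + t = wordDist S x y := by
  obtain ⟨l, hl, hp, hn⟩ := wl_exists S hS (x⁻¹ * y)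
  refine ⟨x * (l.take t).prod, ?_⟩
  have h1 : wordDist S x (x * (l.take t).prod) ≤ t := by
    unfold wordDist
    have := wl_le S (l := l.take t) (fun z hz => hl z (List.mem_of_mem_take hz))
    simp only [inv_mul_cancel_left]
    exact this.trans (List.length_take_le _ _)
  have h2 : wordDist S (x * (l.take t).prod) y ≤ l.length - t := by
    unfold wordDist
    have := wl_le S (l := l.drop t) (fun z hz => hl z (List.mem_of_mem_drop hz))
    have e : (x * (l.take t).prod)⁻¹ * y = (l.drop t).prod := by
      have := List.prod_take_mul_prod_drop l t
      rw [hp] at this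
      rw [mul_inv_rev, mul_assoc, ← this, inv_mul_cancel_left]
    rw [e]
    simpa using this
  have h3 := d_tri S hS x (x * (l.take t).prod) y
  have h4 : l.length = wordDist S x y := hn
  omega

/-- Contraction of a set, in a natural-number form. -/
def Contr (D : ℕ) (P : Set G) : Prop :=
  ∀ g₀ : G, ∀ r : ℕ, (∀ h ∈ P, r < wordDist S g₀ h) → ∀ x y p q : G,
    wordDist S g₀ x ≤ r → wordDist S g₀ y ≤ r → p ∈ projPt S P x → q ∈ projPt S P y →
      wordDist S p q ≤ D

theorem contr_iff (D : ℝ) (hD : 0 ≤ D) (w : List G) :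
    IsContractingWord S D w ↔ IsGeodesicWord S w ∧
      ∀ i j : ℕ, i ≤ j → j ≤ w.length → Contr S ⌊D⌋₊ (segVerts w i j) := by
  unfold IsContractingWord
  refine and_congr_right fun _ => ?_
  refine forall_congr' fun i => forall_congr' fun j => forall_congr' fun _ => forall_congr' fun _ => ?_
  constructor
  · intro H g₀ r hd x y p q hx hy hp hq
    rw [Nat.le_floor_iff hD]
    refine H g₀ r ?_ p ?_ q ?_
    · rw [Set.disjoint_left]
      intro h hh hP
      exact absurd (hd h hP) (not_lt.2 hh)
    · simp only [projSet, Set.mem_iUnion]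
      exact ⟨x, hx, hp⟩
    · simp only [projSet, Set.mem_iUnion]
      exact ⟨y, hy, hq⟩
  · intro H g₀ r hd p hp q hq
    simp only [projSet, Set.mem_iUnion] at hp hq
    obtain ⟨x, hx, hp⟩ := hp
    obtain ⟨y, hy, hq⟩ := hq
    rw [← Nat.le_floor_iff hD]
    refine H g₀ r ?_ x y p q hx hy hp hq
    intro h hP
    by_contra hlt
    exact Set.disjoint_left.1 hd (show h ∈ wordBall S g₀ r from not_lt.1 hlt) hP

theorem proj_exists {P : Set G} (hP : P.Nonempty) (x : G) : ∃ p, p ∈ projPt S P x := by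
  obtain ⟨p, hp, hm⟩ := WellFounded.has_min
    (InvImage.wf (fun p => wordDist S x p) Nat.lt_wfRel.wf) P hP
  exact ⟨p, hp, fun q hq => not_lt.1 (hm q hq)⟩

theorem contr_translate {D : ℕ} {P Q : Set G} (g : G)
    (hQ : ∀ h, h ∈ Q ↔ g * h ∈ P) (H : Contr S D P) : Contr S D Q := by
  have key : ∀ x p, p ∈ projPt S Q x → g * p ∈ projPt S P (g * x) := by
    intro x p hp
    refine ⟨(hQ p).1 hp.1, fun q hq => ?_⟩
    have := hp.2 (g⁻¹ * q) ((hQ _).2 (by simpa using hq))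
    rw [← d_mul S g x, ← d_mul S g x] at this
    simpa using this
  intro g₀ r hd x y p q hx hy hp hq
  have := H (g * g₀) r ?_ (g * x) (g * y) (g * p) (g * q) (by rwa [d_mul]) (by rwa [d_mul])
    (key _ _ hp) (key _ _ hq)
  · rwa [d_mul] at this
  · intro h hh
    have := hd (g⁻¹ * h) ((hQ _).2 (by simpa using hh))
    rw [← d_mul S g] at this
    simpa using this

/-- crude reverse triangle inequality -/
theorem rev_tri0 (hS : Subgroup.closure (S : Set G) = ⊤) {D : ℕ} {P : Set G} (H : Contr S D P)
    (q : G) (hq : q ∈ P) : ∀ n : ℕ, ∀ z p : G, wordDist S z q ≤ n → p ∈ projPt S P z →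
      wordDist S p q ≤ wordDist S z q + (D + 1) := by
  intro n
  induction n with
  | zero =>
    intro z p hz hp
    have h1 := hp.2 q hq
    have h2 := d_tri S hS p z q
    have h3 := d_comm S hS p z
    omega
  | succ n ih =>
    intro z p hz hp
    by_cases hm : wordDist S z p ≤ D + 1
    · have h2 := d_tri S hS p z q
      have h3 := d_comm S hS p z
      omega
    · have h1 := hp.2 q hq
      obtain ⟨z', hz1, hz2⟩ := d_split S hS z q (wordDist S z p - 1) (by omega)
      obtain ⟨p', hp'⟩ := proj_exists S ⟨q, hq⟩ z'
      have h4 := ih z' p' (by omega) hp'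
      have h5 := H z (wordDist S z p - 1) (fun h hh => by have := hp.2 h hh; omega) z z' p p'
        (by rw [d_self]; omega) (by omega) hp hp'
      have h6 := d_tri S hS p p' q
      omega

theorem rev_tri (hS : Subgroup.closure (S : Set G) = ⊤) {D : ℕ} {P : Set G} (H : Contr S D P)
    (q : G) (hq : q ∈ P) (z p : G) (hp : p ∈ projPt S P z) :
      wordDist S z p + wordDist S p q ≤ wordDist S z q + (2 * D + 2) := by
  by_cases hm : wordDist S z p = 0
  · have := d_zero S hS hm
    subst this
    omega
  · have h1 := hp.2 q hq
    obtain ⟨z', hz1, hz2⟩ := d_split S hS z q (wordDist S z p - 1) (by omega)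
    obtain ⟨p', hp'⟩ := proj_exists S ⟨q, hq⟩ z'
    have h4 := rev_tri0 S hS H q hq _ z' p' le_rfl hp'
    have h5 := H z (wordDist S z p - 1) (fun h hh => by have := hp.2 h hh; omega) z z' p p'
      (by rw [d_self]; omega) (by omega) hp hp'
    have h6 := d_tri S hS p p' q
    omega

theorem geo_dist (hS : Subgroup.closure (S : Set G) = ⊤) {w : List G} (hw : IsGeodesicWord S w)
    {i j : ℕ} (hij : i ≤ j) (hj : j ≤ w.length) :
    wordDist S (w.take i).prod (w.take j).prod = j - i := by
  have up : ∀ i j : ℕ, i ≤ j → j ≤ w.length →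
      wordDist S (w.take i).prod (w.take j).prod ≤ j - i := by
    intro i j hij hj
    have e : ((w.take i).prod)⁻¹ * (w.take j).prod = ((w.take j).drop i).prod := by
      have := List.prod_take_mul_prod_drop (w.take j) i
      rw [List.take_take, min_eq_left hij] at this
      rw [← this]
      simp
    unfold wordDist
    rw [e]
    have := wl_le S (l := (w.take j).drop i)
      (fun z hz => hw.1 z (List.mem_of_mem_take (List.mem_of_mem_drop hz)))
    simpa [min_eq_left hj] using this
  have h0 : wordDist S (w.take 0).prod (w.take w.length).prod = w.length := by
    have := hw.2
    simpa [wordDist] using this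
  have h1 := up 0 i (by omega) (by omega)
  have h2 := up i j hij hj
  have h3 := up j w.length hj le_rfl
  have h4 := d_tri S hS (w.take 0).prod (w.take i).prod (w.take w.length).prod
  have h5 := d_tri S hS (w.take i).prod (w.take j).prod (w.take w.length).prod
  omega

theorem geo_append (hS : Subgroup.closure (S : Set G) = ⊤) {u v : List G}
    (h : IsGeodesicWord S (u ++ v)) : IsGeodesicWord S u ∧ IsGeodesicWord S v := by
  have hu : ∀ x ∈ u, IsLetter S x := fun x hx => h.1 x (by simp [hx])
  have hv : ∀ x ∈ v, IsLetter S x := fun x hx => h.1 x (by simp [hx])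
  have h1 := wl_le S hu
  have h2 := wl_le S hv
  have h3 := wl_mul S hS u.prod v.prod
  have h4 := h.2
  rw [List.prod_append, List.length_append] at h4
  exact ⟨⟨hu, by omega⟩, ⟨hv, by omega⟩⟩

theorem seg_append_left (u v : List G) {i j : ℕ} (hj : j ≤ u.length) :
    segVerts (u ++ v) i j = segVerts u i j := by
  ext g
  constructor
  · rintro ⟨k, h1, h2, h3⟩
    refine ⟨k, h1, h2, ?_⟩
    rwa [List.take_append_of_le_length (by omega)] at h3
  · rintro ⟨k, h1, h2, h3⟩
    refine ⟨k, h1, h2, ?_⟩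
    rwa [List.take_append_of_le_length (by omega)]

theorem seg_append_right (u v : List G) (i j : ℕ) (h : G) :
    h ∈ segVerts v i j ↔ u.prod * h ∈ segVerts (u ++ v) (u.length + i) (u.length + j) := by
  constructor
  · rintro ⟨k, h1, h2, rfl⟩
    refine ⟨u.length + k, by omega, by omega, ?_⟩
    rw [List.take_append, List.take_of_length_le (by omega)]
    simp
  · rintro ⟨k, h1, h2, h3⟩
    refine ⟨k - u.length, by omega, by omega, ?_⟩
    rw [List.take_append, List.take_of_length_le (by omega)] at h3
    simpa using h3

/-- The language. -/
def L (D : ℕ) : Set (List G) := {w | IsGeodesicWord S w ∧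
      ∀ i j : ℕ, i ≤ j → j ≤ w.length → Contr S D (segVerts w i j)}

theorem L_append (hS : Subgroup.closure (S : Set G) = ⊤) {D : ℕ} {u v : List G}
    (h : u ++ v ∈ L S D) : u ∈ L S D ∧ v ∈ L S D := by
  have hg := geo_append S hS h.1
  refine ⟨⟨hg.1, ?_⟩, ⟨hg.2, ?_⟩⟩
  · intro i j hij hj
    rw [← seg_append_left u v hj]
    exact h.2 i j hij (by simp; omega)
  · intro i j hij hj
    exact contr_translate S u.prod (seg_append_right u v i j)
      (h.2 _ _ (by omega) (by simp; omega))

theorem proj_mono {P Q : Set G} (hPQ : Q ⊆ P) {x p : G} (hp : p ∈ projPt S P x) (hq : p ∈ Q) :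
    p ∈ projPt S Q x := ⟨hq, fun q h => hp.2 q (hPQ h)⟩

theorem seg_mono (w : List G) {i i' j j' : ℕ} (h : i ≤ i') (h' : j' ≤ j) :
    segVerts w i' j' ⊆ segVerts w i j := by
  rintro g ⟨k, h1, h2, h3⟩
  exact ⟨k, by omega, by omega, h3⟩

theorem L_snoc_aux (hS : Subgroup.closure (S : Set G) = ⊤) {D N : ℕ} (hN : 4 * D + 5 ≤ N)
    {W : List G} {a : G} (hW : W ∈ L S D) (hg : IsGeodesicWord S (W ++ [a]))
    (hs : ∀ u s, W ++ [a] = u ++ s → s.length ≤ N → s ∈ L S D) (i : ℕ)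
    (g₀ : G) (r : ℕ) (hd : ∀ h ∈ segVerts (W ++ [a]) i (W.length + 1), r < wordDist S g₀ h)
    (x y q : G) (hx : wordDist S g₀ x ≤ r) (hy : wordDist S g₀ y ≤ r) (k : ℕ) (hik : i ≤ k)
    (hk : k ≤ W.length)
    (hp : ((W ++ [a]).take k).prod ∈ projPt S (segVerts (W ++ [a]) i (W.length + 1)) x)
    (hqe : q = ((W ++ [a]).take (W.length + 1)).prod)
    (hq : q ∈ projPt S (segVerts (W ++ [a]) i (W.length + 1)) y) :
    wordDist S ((W ++ [a]).take k).prod q ≤ D := by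
  set p := ((W ++ [a]).take k).prod with hpdef
  by_cases hlen : W.length + 1 - k ≤ N
  · -- short suffix
    have e : W ++ [a] = (W ++ [a]).take k ++ (W ++ [a]).drop k := (List.take_append_drop _ _).symm
    have hsl : ((W ++ [a]).drop k).length = W.length + 1 - k := by simp
    have h1 := (hs _ _ e (by omega)).2 0 (W.length + 1 - k) (by omega) (by omega)
    have h2 : Contr S D (segVerts (W ++ [a]) k (W.length + 1)) := by
      refine contr_translate S p⁻¹ (fun h => ?_) h1
      rw [seg_append_right ((W ++ [a]).take k) ((W ++ [a]).drop k), ← e]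
      have : ((W ++ [a]).take k).length = k := by simp; omega
      rw [this, ← hpdef, mul_inv_cancel_left, add_zero, Nat.add_sub_cancel' (by omega)]
    have hm : segVerts (W ++ [a]) k (W.length + 1) ⊆ segVerts (W ++ [a]) i (W.length + 1) :=
      seg_mono _ hik le_rfl
    exact h2 g₀ r (fun h hh => hd h (hm hh)) x y p q hx hy
      (proj_mono S hm hp ⟨k, le_rfl, by omega, rfl⟩)
      (proj_mono S hm hq ⟨W.length + 1, by omega, le_rfl, hqe.symm⟩)
  · exfalso
    have hm : segVerts (W ++ [a]) k W.length ⊆ segVerts (W ++ [a]) i (W.length + 1) :=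
      seg_mono _ hik (by omega)
    have hC : Contr S D (segVerts (W ++ [a]) k W.length) := by
      rw [seg_append_left _ _ le_rfl]
      exact hW.2 _ _ hk le_rfl
    set q' := ((W ++ [a]).take W.length).prod with hq'
    have hq'm : q' ∈ segVerts (W ++ [a]) k W.length := ⟨W.length, hk, le_rfl, rfl⟩
    obtain ⟨t, ht⟩ := proj_exists S ⟨q', hq'm⟩ y
    have h1 := hC g₀ r (fun h hh => hd h (hm hh)) x y p t hx hy
      (proj_mono S hm hp ⟨k, le_rfl, hk, rfl⟩) ht
    have h2 : wordDist S q' q = 1 := by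
      rw [hqe, geo_dist S hS hg (by omega) (by simp)]; omega
    have h3 : wordDist S p q' = W.length - k := geo_dist S hS hg hk (by simp)
    have h4 := hq.2 t (hm ht.1)
    have h5 := d_tri S hS y q q'
    have h6 := d_comm S hS q q'
    have h7 := rev_tri S hS hC q' hq'm y t ht
    have h8 := d_tri S hS p t q'
    omega

theorem L_snoc (hS : Subgroup.closure (S : Set G) = ⊤) {D N : ℕ} (hN : 4 * D + 5 ≤ N)
    {W : List G} {a : G} (hW : W ∈ L S D) (hg : IsGeodesicWord S (W ++ [a]))
    (hs : ∀ u s, W ++ [a] = u ++ s → s.length ≤ N → s ∈ L S D) : W ++ [a] ∈ L S D := by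
  refine ⟨hg, fun i j hij hj => ?_⟩
  by_cases hj' : j ≤ W.length
  · rw [seg_append_left _ _ hj']
    exact hW.2 _ _ hij hj'
  have hj1 : j = W.length + 1 := by simp at hj; omega
  subst hj1
  intro g₀ r hd x y p q hx hy hp hq
  obtain ⟨k, hk1, hk2, hk3⟩ := hp.1
  obtain ⟨l, hl1, hl2, hl3⟩ := hq.1
  by_cases hk : k ≤ W.length
  · by_cases hl : l ≤ W.length
    · have hm : segVerts (W ++ [a]) i W.length ⊆ segVerts (W ++ [a]) i (W.length + 1) :=
        seg_mono _ le_rfl (by omega)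
      have hC : Contr S D (segVerts (W ++ [a]) i W.length) := by
        rw [seg_append_left _ _ le_rfl]
        exact hW.2 _ _ (by omega) le_rfl
      exact hC g₀ r (fun h hh => hd h (hm hh)) x y p q hx hy
        (proj_mono S hm hp ⟨k, hk1, hk, hk3⟩) (proj_mono S hm hq ⟨l, hl1, hl, hl3⟩)
    · have : l = W.length + 1 := by omega
      subst this hk3
      exact L_snoc_aux S hS hN hW hg hs i g₀ r hd x y q hx hy k hk1 hk hp hl3.symm hq
  · have : k = W.length + 1 := by omega
    subst this
    by_cases hl : l ≤ W.length
    · subst hl3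
      rw [d_comm S hS]
      exact L_snoc_aux S hS hN hW hg hs i g₀ r hd y x p hy hx l hl1 hl hq hk3.symm hp
    · have : l = W.length + 1 := by omega
      subst this
      rw [← hk3, ← hl3, d_self]
      omega

/-- Morse step. -/
theorem morse (hS : Subgroup.closure (S : Set G) = ⊤) {D N : ℕ} (hN : 4 * D + 5 ≤ N)
    {w v : List G} {a : G} (ha : IsLetter S a) (hW : w ++ v ∈ L S D)
    (hn : wordLength S (w ++ v ++ [a]).prod ≤ w.length + v.length) :
    ∃ h : G, wordLength S h ≤ N ∧
      wordLength S (w.prod * h) + wordLength S (h⁻¹ * (v ++ [a]).prod) ≤ w.length + v.length := by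
  set z := (w ++ v ++ [a]).prod with hz
  set W := w ++ v with hWd
  have hWl : W.length = w.length + v.length := by simp [hWd]
  have h1z : wordDist S 1 z = wordLength S z := by simp [wordDist]
  have hez : wordDist S W.prod z ≤ 1 := by
    have : wordDist S W.prod z = wordLength S a := by
      simp [wordDist, hz]
    rw [this]; exact wl_letter S ha
  have h1e : wordDist S 1 W.prod = W.length := by
    have := hW.1.2
    simpa [wordDist] using this
  have t1 := d_tri S hS 1 z W.prod
  have t2 := d_comm S hS z W.prod
  obtain ⟨s, hs1, hs2⟩ := d_split S hS 1 z (w.length - 1) (by omega)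
  have hC := hW.2 0 W.length (by omega) le_rfl
  have h1m : (1 : G) ∈ segVerts W 0 W.length := ⟨0, le_rfl, by omega, by simp⟩
  have hem : W.prod ∈ segVerts W 0 W.length := ⟨W.length, by omega, le_rfl, by simp⟩
  obtain ⟨p, hp⟩ := proj_exists S ⟨_, h1m⟩ s
  obtain ⟨k, hk1, hk2, hk3⟩ := hp.1
  have r1 := rev_tri S hS hC _ h1m s p hp
  have r2 := rev_tri S hS hC _ hem s p hp
  have p1 : wordDist S p 1 = k := by
    have := geo_dist S hS hW.1 (i := 0) (j := k) (by omega) hk2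
    rw [d_comm S hS]
    simpa [hk3] using this
  have p2 : wordDist S p W.prod = W.length - k := by
    have := geo_dist S hS hW.1 (i := k) (j := W.length) hk2 le_rfl
    simpa [hk3] using this
  have hwu : (W.take w.length).prod = w.prod := by simp [hWd]
  have p3 : wordDist S p w.prod ≤ (k - w.length) + (w.length - k) := by
    rw [← hwu, ← hk3]
    rcases le_total k w.length with h | h
    · rw [geo_dist S hS hW.1 h (by omega)]; omega
    · rw [d_comm S hS, geo_dist S hS hW.1 h (by omega)]; omega
  have s1 := d_comm S hS 1 s
  have t3 := d_tri S hS s z W.prod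
  have t4 := d_tri S hS s p 1
  have t5 := d_tri S hS s p w.prod
  have t6 := d_tri S hS 1 p s
  have t7 := d_comm S hS s p
  refine ⟨w.prod⁻¹ * s, ?_, ?_⟩
  · have : wordLength S (w.prod⁻¹ * s) = wordDist S w.prod s := rfl
    rw [this, d_comm S hS]
    omega
  · have e1 : wordLength S (w.prod * (w.prod⁻¹ * s)) = wordDist S 1 s := by simp [wordDist]
    have e2 : wordLength S ((w.prod⁻¹ * s)⁻¹ * (v ++ [a]).prod) = wordDist S s z := by
      simp [wordDist, hz, hWd, mul_assoc]
    rw [e1, e2]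
    omega

theorem nerode (hS : Subgroup.closure (S : Set G) = ⊤) {D N : ℕ} (hN : 4 * D + 5 ≤ N)
    {w w' : List G} (hw' : w' ∈ L S D)
    (hlast : w.drop (w.length - N) = w'.drop (w'.length - N))
    (htype : ∀ h, wordLength S h ≤ N → (wordLength S (w.prod * h) : ℤ) - w.length =
      (wordLength S (w'.prod * h) : ℤ) - w'.length) (v : List G) (hv : w ++ v ∈ L S D) :
    w' ++ v ∈ L S D := by
  induction v using List.reverseRecOn with
  | nil => simpa using hw'
  | append_singleton v a ih =>
    have hpre : w ++ v ∈ L S D := by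
      rw [← List.append_assoc] at hv
      exact (L_append S hS hv).1
    have hv' := ih hpre
    have ha : IsLetter S a := hv.1.1 a (by simp)
    rw [← List.append_assoc]
    refine L_snoc S hS (N := N) (by omega) hv' ⟨?_, ?_⟩ ?_
    · intro x hx
      rcases List.mem_append.1 hx with hx | hx
      · exact hv'.1.1 x hx
      · simp at hx; subst hx; exact ha
    · have hl : ∀ x ∈ w' ++ v ++ [a], IsLetter S x := by
        intro x hx
        rcases List.mem_append.1 hx with hx | hx
        · exact hv'.1.1 x hx
        · simp at hx; subst hx; exact ha
      have hle := wl_le S hl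
      by_contra hne
      have hlt : wordLength S (w' ++ v ++ [a]).prod ≤ w'.length + v.length := by
        simp only [List.length_append, List.length_singleton] at hle hne
        omega
      obtain ⟨h, h1, h2⟩ := morse S hS hN ha hv' hlt
      have h3 := htype h h1
      have h4 := wl_mul S hS (w.prod * h) (h⁻¹ * (v ++ [a]).prod)
      have h5 := hv.1.2
      have e : w.prod * h * (h⁻¹ * (v ++ [a]).prod) = (w ++ (v ++ [a])).prod := by
        simp [mul_assoc]
      rw [e, h5] at h4
      simp only [List.length_append, List.length_singleton] at h4
      omega
    · intro u s hus hsN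
      rw [List.append_assoc, List.append_eq_append_iff] at hus
      rcases hus with ⟨c, hc1, hc2⟩ | ⟨c, hc1, hc2⟩
      · -- s is a suffix of v ++ [a]
        rw [hc2, ← List.append_assoc] at hv
        exact (L_append S hS hv).2
      · -- s = c ++ (v ++ [a]), w' = u ++ c
        have hc : c.length ≤ N := by
          have := congrArg List.length hc2
          simp only [List.length_append] at this
          omega
        have hsuf : c <:+ w := by
          have h1 : c <:+ w'.drop (w'.length - N) := by
            have : w'.drop (w'.length - N) = u.drop (w'.length - N) ++ c := by
              conv_lhs => rw [hc1]
              rw [List.drop_append_of_le_length]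
              · rw [← hc1]
              · simp; omega
            rw [this]
            exact List.suffix_append _ _
          rw [← hlast] at h1
          exact h1.trans (List.drop_suffix _ _)
        obtain ⟨t, ht⟩ := hsuf
        rw [← ht, List.append_assoc, ← hc2] at hv
        exact (L_append S hS hv).2

end CGr

namespace CGr

variable {G : Type} [Group G] (S : Finset G)

open Classical in
/-- The alphabet as a finset. -/
noncomputable def alph : Finset G := S ∪ S.image (fun x => x⁻¹)

theorem mem_alph (a : G) : a ∈ alph S ↔ IsLetter S a := by
  simp only [alph, Finset.mem_union, Finset.mem_image, IsLetter]
  refine or_congr_right ?_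
  constructor
  · rintro ⟨b, hb, rfl⟩; simpa using hb
  · intro h; exact ⟨a⁻¹, h, by simp⟩

open Classical in
/-- Continuations `v` of `w` of length at most `n` with `w ++ v ∈ A`. -/
noncomputable def conts (A : Set (List G)) : ℕ → List G → Finset (List G)
  | 0, w => if w ∈ A then {[]} else ∅
  | n + 1, w => (if w ∈ A then {[]} else ∅) ∪
      (alph S).biUnion (fun a => (conts A n (w ++ [a])).image (List.cons a))

theorem mem_conts (A : Set (List G)) (hA : ∀ w ∈ A, ∀ x ∈ w, IsLetter S x) (n : ℕ) :
    ∀ w v : List G, v ∈ conts S A n w ↔ v.length ≤ n ∧ w ++ v ∈ A := by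
  induction n with
  | zero =>
    intro w v
    by_cases h : w ∈ A
    · simp only [conts, h, if_true, Finset.mem_singleton, Nat.le_zero, List.length_eq_zero_iff]
      constructor
      · rintro rfl; simpa using h
      · exact fun h => h.1
    · simp only [conts, h, if_false, Finset.notMem_empty, Nat.le_zero, List.length_eq_zero_iff,
        false_iff]
      rintro ⟨rfl, h'⟩
      exact h (by simpa using h')
  | succ n ih =>
    intro w v
    simp only [conts, Finset.mem_union, Finset.mem_biUnion, Finset.mem_image, ih]
    cases v with
    | nil =>
      by_cases h : w ∈ A <;> simp [h]
    | cons b v =>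
      constructor
      · rintro (h | ⟨a, ha, v', ⟨h1, h2⟩, h3⟩)
        · exact absurd h (by split_ifs <;> simp)
        · cases h3
          exact ⟨by simpa using h1, by simpa using h2⟩
      · rintro ⟨h1, h2⟩
        refine Or.inr ⟨b, (mem_alph S b).2 (hA _ h2 b (by simp)), v, ⟨by simpa using h1,
          by simpa using h2⟩, rfl⟩

open Classical in
theorem card_conts (A : Set (List G)) (n : ℕ) (w : List G) :
    (conts S A (n + 1) w).card = (if w ∈ A then 1 else 0) +
      ∑ a ∈ alph S, (conts S A n (w ++ [a])).card := by
  rw [conts, Finset.card_union_of_disjoint, Finset.card_biUnion]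
  · congr 1
    · split_ifs <;> simp
    · refine Finset.sum_congr rfl fun a _ => ?_
      exact Finset.card_image_of_injective _ (List.cons_injective)
  · intro a _ b _ hab
    refine Finset.disjoint_left.2 ?_
    intro v hv hv'
    simp only [Finset.mem_image] at hv hv'
    obtain ⟨x, _, rfl⟩ := hv
    obtain ⟨y, _, h⟩ := hv'
    injection h with h1 h2
    exact hab h1.symm
  · rw [Finset.disjoint_left]
    intro v hv hv'
    simp only [Finset.mem_biUnion, Finset.mem_image] at hv'
    obtain ⟨a, _, x, _, rfl⟩ := hv'
    split_ifs at hv <;> simp at hv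

theorem finite_words (N : ℕ) :
    {l : List G | l.length ≤ N ∧ ∀ x ∈ l, IsLetter S x}.Finite := by
  refine (Finset.finite_toSet (conts S {l | ∀ x ∈ l, IsLetter S x} N [])).subset ?_
  rintro l ⟨h1, h2⟩
  rw [Finset.mem_coe, mem_conts S {l | ∀ x ∈ l, IsLetter S x} (fun w hw => hw)]
  exact ⟨h1, by simpa using h2⟩

theorem finite_ball (hS : Subgroup.closure (S : Set G) = ⊤) (N : ℕ) :
    {h : G | wordLength S h ≤ N}.Finite := by
  refine ((finite_words S N).image List.prod).subset ?_
  intro h hh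
  obtain ⟨l, h1, h2, h3⟩ := wl_exists S hS h
  exact ⟨l, ⟨by rw [h3]; exact hh, h1⟩, h2⟩

/-- The state of a word. -/
noncomputable def st (N : ℕ) (w : List G) : List G × ({h : G | wordLength S h ≤ N} → ℤ) :=
  (w.drop (w.length - N), fun h => (wordLength S (w.prod * h.1) : ℤ) - w.length)

theorem finite_st (hS : Subgroup.closure (S : Set G) = ⊤) (D N : ℕ) :
    (st S N '' L S D).Finite := by
  have : Finite {h : G | wordLength S h ≤ N} := finite_ball S hS N
  have hf : (Set.pi Set.univ (fun _ : {h : G | wordLength S h ≤ N} =>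
    Set.Icc (-(N : ℤ)) N)).Finite := Set.Finite.pi fun _ => Set.finite_Icc _ _
  refine ((finite_words S N).prod hf).subset ?_
  rintro _ ⟨w, hw, rfl⟩
  refine ⟨⟨by simp [st]; omega, fun x hx => hw.1.1 x (List.mem_of_mem_drop hx)⟩, ?_⟩
  intro h _
  have h1 := wl_mul S hS w.prod h.1
  have h2 := wl_mul S hS (w.prod * h.1) h.1⁻¹
  rw [mul_inv_cancel_right, wl_inv S hS] at h2
  have h3 := hw.1.2
  have h4 : wordLength S h.1 ≤ N := h.2
  simp only [st, Set.mem_Icc]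
  omega

/-- Counting sequence of continuations. -/
noncomputable def cs (D : ℕ) (w : List G) : ℕ → ℤ := fun n => ((conts S (L S D) n w).card : ℤ)

theorem L_letters {D : ℕ} : ∀ w ∈ L S D, ∀ x ∈ w, IsLetter S x := fun _ hw => hw.1.1

theorem cs_eq (hS : Subgroup.closure (S : Set G) = ⊤) {D N : ℕ} (hN : 4 * D + 5 ≤ N)
    {w w' : List G} (hw : w ∈ L S D) (hw' : w' ∈ L S D) (h : st S N w = st S N w') :
    cs S D w = cs S D w' := by
  have h1 : w.drop (w.length - N) = w'.drop (w'.length - N) := congrArg Prod.fst h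
  have h2 : ∀ h, wordLength S h ≤ N → (wordLength S (w.prod * h) : ℤ) - w.length =
      (wordLength S (w'.prod * h) : ℤ) - w'.length := fun g hg =>
    congrFun (congrArg Prod.snd h) ⟨g, hg⟩
  funext n
  unfold cs
  congr 2
  ext v
  rw [mem_conts S _ (L_letters S), mem_conts S _ (L_letters S)]
  refine and_congr_right fun _ => ⟨nerode S hS hN hw' h1 h2 v,
    nerode S hS hN hw h1.symm (fun h hh => (h2 h hh).symm) v⟩

theorem finite_cs (hS : Subgroup.closure (S : Set G) = ⊤) (D : ℕ) :
    (Set.range (cs S D)).Finite := by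
  classical
  set N := 4 * D + 5
  set g := fun s => cs S D (Function.invFunOn (st S N) (L S D) s)
  refine (((finite_st S hS D N).image g).union (Set.finite_singleton 0)).subset ?_
  rintro _ ⟨w, rfl⟩
  by_cases hw : w ∈ L S D
  · left
    have hm : st S N w ∈ st S N '' L S D := ⟨w, hw, rfl⟩
    refine ⟨_, hm, ?_⟩
    exact cs_eq S hS (N := N) le_rfl (Function.invFunOn_mem hm) hw (Function.invFunOn_eq hm)
  · right
    rw [Set.mem_singleton_iff]
    funext n
    simp only [cs, Pi.zero_apply, Nat.cast_eq_zero, Finset.card_eq_zero]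
    rw [Finset.eq_empty_iff_forall_notMem]
    intro v hv
    rw [mem_conts S _ (L_letters S)] at hv
    exact hw (L_append S hS hv.2).1

/-- The shift. -/
def shift : (ℕ → ℤ) →ₗ[ℤ] (ℕ → ℤ) where
  toFun f n := f (n + 1)
  map_add' _ _ := rfl
  map_smul' _ _ := rfl

theorem shift_pow (i : ℕ) (f : ℕ → ℤ) (n : ℕ) : (shift ^ i) f n = f (n + i) := by
  induction i generalizing f n with
  | zero => simp
  | succ i ih =>
    rw [pow_succ, Module.End.mul_apply, ih]
    simp [shift, add_assoc]

theorem rec_of_span (M : Submodule ℤ (ℕ → ℤ)) (hM : M.FG) (hs : ∀ f ∈ M, shift f ∈ M)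
    (f : ℕ → ℤ) (hf : f ∈ M) :
    ∃ k : ℕ, 1 ≤ k ∧ ∃ c : Fin k → ℤ,
      ∀ n : ℕ, f (n + k) = ∑ i : Fin k, c i * f (n + k - 1 - (i : ℕ)) := by
  have : Module.Finite ℤ M := Module.Finite.iff_fg.2 hM
  obtain ⟨p, hp, h0⟩ := LinearMap.exists_monic_and_aeval_eq_zero ℤ (shift.restrict hs)
  set q := Polynomial.X * p with hq
  have hqm : q.Monic := Polynomial.monic_X.mul hp
  have hq0 : Polynomial.aeval (shift.restrict hs) q = 0 := by simp [hq, h0]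
  have hdeg : q.natDegree = p.natDegree + 1 := by
    rw [hq, Polynomial.natDegree_X_mul hp.ne_zero]
  have key : ∀ n, ∑ i ∈ Finset.range (q.natDegree + 1), q.coeff i * f (n + i) = 0 := by
    intro n
    have h1 : (Polynomial.aeval (shift.restrict hs) q) ⟨f, hf⟩ = 0 := by rw [hq0]; rfl
    rw [Polynomial.aeval_eq_sum_range, LinearMap.sum_apply] at h1
    have h2 := congrFun (congrArg Subtype.val h1) n
    rw [AddSubmonoidClass.coe_finsetSum, Finset.sum_apply] at h2
    rw [← show _ = (0 : ℤ) from h2]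
    refine Finset.sum_congr rfl fun i _ => ?_
    rw [LinearMap.smul_apply, Module.End.pow_restrict i]
    simp [shift_pow]
  refine ⟨q.natDegree, by omega, fun i => - q.coeff (q.natDegree - 1 - i), fun n => ?_⟩
  have h := key n
  rw [Finset.sum_range_succ, hqm.coeff_natDegree, one_mul] at h
  rw [Fin.sum_univ_eq_sum_range
    (fun i => - q.coeff (q.natDegree - 1 - i) * f (n + q.natDegree - 1 - i)) q.natDegree]
  rw [← Finset.sum_range_reflect] at h
  have h3 : ∑ i ∈ Finset.range q.natDegree,
      - q.coeff (q.natDegree - 1 - i) * f (n + q.natDegree - 1 - i) =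
      - ∑ i ∈ Finset.range q.natDegree,
      q.coeff (q.natDegree - 1 - i) * f (n + (q.natDegree - 1 - i)) := by
    rw [← Finset.sum_neg_distrib]
    refine Finset.sum_congr rfl fun i hi => ?_
    have := Finset.mem_range.1 hi
    rw [show n + q.natDegree - 1 - i = n + (q.natDegree - 1 - i) by omega]
    ring
  rw [h3]
  linarith

theorem main (hS : Subgroup.closure (S : Set G) = ⊤) (D : ℕ) :
    ∃ k : ℕ, 1 ≤ k ∧ ∃ c : Fin k → ℤ,
      ∀ n : ℕ, cs S D [] (n + k) = ∑ i : Fin k, c i * cs S D [] (n + k - 1 - (i : ℕ)) := by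
  classical
  set X : Set (ℕ → ℤ) := insert 1 (Set.range (cs S D)) with hX
  have hcs : ∀ w, cs S D w ∈ Submodule.span ℤ X := fun w =>
    Submodule.subset_span (Or.inr ⟨w, rfl⟩)
  have h1 : (1 : ℕ → ℤ) ∈ Submodule.span ℤ X := Submodule.subset_span (Or.inl rfl)
  refine rec_of_span (Submodule.span ℤ X) (Submodule.fg_span ((finite_cs S hS D).insert 1))
    ?_ _ (hcs [])
  intro f hf
  have hle : Submodule.span ℤ X ≤ (Submodule.span ℤ X).comap shift := by
    rw [Submodule.span_le]
    rintro _ (rfl | ⟨w, rfl⟩)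
    · exact h1
    · have : shift (cs S D w) = (if w ∈ L S D then (1 : ℕ → ℤ) else 0) +
          ∑ a ∈ alph S, cs S D (w ++ [a]) := by
        funext n
        have := card_conts S (L S D) n w
        simp only [shift, cs, LinearMap.coe_mk, AddHom.coe_mk, Pi.add_apply, Finset.sum_apply,
          this]
        split_ifs <;> simp
      rw [SetLike.mem_coe, Submodule.mem_comap, this]
      refine Submodule.add_mem _ ?_ (Submodule.sum_mem _ fun a _ => hcs _)
      split_ifs
      · exact h1
      · exact Submodule.zero_mem _
  exact hle hf

end CGr


/-- the number `b n` of `D`-contracting geodesic words of length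
at most `n` satisfies a linear recursion with integer coefficients. -/
theorem contracting_growth_linear_recursion {G : Type} [Group G] (S : Finset G)
    (hS : Subgroup.closure (S : Set G) = ⊤) (D : ℝ) (hD : 0 ≤ D)
    (b : ℕ → ℕ)
    (hb : ∀ n, b n = Set.ncard {w : List G | w.length ≤ n ∧ IsContractingWord S D w}) :
    ∃ k : ℕ, 1 ≤ k ∧ ∃ c : Fin k → ℤ,
      ∀ n : ℕ, (b (n + k) : ℤ) = ∑ i : Fin k, c i * (b (n + k - 1 - (i : ℕ)) : ℤ) := by
  have hbc : ∀ n, (b n : ℤ) = CGr.cs S ⌊D⌋₊ [] n := by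
    intro n
    rw [hb n, CGr.cs, ← Set.ncard_coe_finset]
    congr 2
    ext w
    rw [Finset.mem_coe, CGr.mem_conts S _ (CGr.L_letters S), List.nil_append]
    exact and_congr_right fun _ => CGr.contr_iff S D hD w
  simp only [hbc]
  exact CGr.main S hS ⌊D⌋₊
end
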